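/- For every finitely generated left-orderable group G there exist a finitely generated left-orderable simple group H, a finite generating set X of G, a finite generating set Y of H, and a Frattini embedding φ : G → H that is isometric, i.e., |φ(g)|_Y = |g|_X for all g ∈ G. -/

import Mathlib

-- The sign (−1, 0, or 1) of a group element relative to the identity,
-- with respect to a linear order `l`.
open Classical in
noncomputable def orderSign {H : Type*} [Group H] (l : LinearOrder H) (h : H) : ℤ :=
  if l.lt h 1 then -1 else if h = 1 then 0 else 1

/-- A group is left-orderable if it carries a left-invariant linear order. -/
def IsLeftOrderable (G : Type*) [Group G] : Prop :=
  ∃ l : LinearOrder G, ∀ a b c : G, l.le b c → l.le (a * b) (a * c)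

/-- A Frattini embedding: an injective homomorphism preserving and reflecting conjugacy. -/
def IsFrattini {G H : Type*} [Group G] [Group H] (φ : G →* H) : Prop :=
  Function.Injective φ ∧ ∀ a b : G, IsConj a b ↔ IsConj (φ a) (φ b)

/-- `X` is a (finite) generating set of the group. -/
def Generates {G : Type*} [Group G] (X : Finset G) : Prop :=
  Subgroup.closure (X : Set G) = ⊤

/-- Word length of `g` with respect to the finite set `X`: the least length of a word
over `X ∪ X⁻¹` representing `g`. -/
noncomputable def wordLength {G : Type*} [Group G] (X : Finset G) (g : G) : ℕ :=
  sInf {n | ∃ w : List G, w.length = n ∧ (∀ a ∈ w, a ∈ X ∨ a⁻¹ ∈ X) ∧ w.prod = g}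

/-- Quasi-isometric embedding with respect to finite generating sets `X` and `Y`. -/
noncomputable def IsQIEmbedding {G H : Type*} [Group G] [Group H]
    (X : Finset G) (Y : Finset H) (φ : G →* H) : Prop :=
  Function.Injective φ ∧ ∃ C k : ℝ, 0 < C ∧ 0 < k ∧ ∀ g : G,
    (1 / C) * (wordLength X g : ℝ) - k ≤ (wordLength Y (φ g) : ℝ) ∧
    (wordLength Y (φ g) : ℝ) ≤ C * (wordLength X g : ℝ) + k

/-- Evaluation of a formal word (list of pairs (index, sign)) over the
enumerated sequence `x : ℕ → G`. -/
def evalWord {G : Type*} [Group G] (x : ℕ → G) (w : List (ℕ × Bool)) : G :=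
  (w.map (fun p => if p.2 then x p.1 else (x p.1)⁻¹)).prod

/-- A computable left order on a countable group with respect to an enumerated
generating sequence `x : ℕ → G`. -/
def ComputableLeftOrderWrt {G : Type*} [Group G] (x : ℕ → G) : Prop :=
  ∃ l : LinearOrder G, (∀ a b c : G, l.le b c → l.le (a * b) (a * c)) ∧
    Computable (fun w : List (ℕ × Bool) => orderSign l (evalWord x w))

/-- A computable left order on a finitely generated group, presented by
a surjection `π` from a free group of finite rank. -/
def ComputableLeftOrderVia {H : Type*} [Group H] {m : ℕ}
    (π : FreeGroup (Fin m) →* H) : Prop :=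
  ∃ l : LinearOrder H, (∀ a b c : H, l.le b c → l.le (a * b) (a * c)) ∧
    Computable (fun w : List (Fin m × Bool) => orderSign l (π (FreeGroup.mk w)))

/-- The embedding `φ` is computable: one can compute, for each `i`, a word over the
generators of `H` representing `φ (x i)`. -/
def ComputableEmbedding {G H : Type*} [Group G] [Group H] (x : ℕ → G) {m : ℕ}
    (π : FreeGroup (Fin m) →* H) (φ : G →* H) : Prop :=
  ∃ f : ℕ → List (Fin m × Bool), Computable f ∧ ∀ i, π (FreeGroup.mk (f i)) = φ (x i)

/-- Decidable membership problem for the image of `φ` in `H`, presented via `π`. -/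
def DecidableMembership {G H : Type*} [Group G] [Group H] {m : ℕ}
    (π : FreeGroup (Fin m) →* H) (φ : G →* H) : Prop :=
  ComputablePred (fun w : List (Fin m × Bool) => π (FreeGroup.mk w) ∈ φ.range)

/-- Decidable word problem for `H`, presented via `π`. -/
def DecidableWordProblemVia {H : Type*} [Group H] {m : ℕ}
    (π : FreeGroup (Fin m) →* H) : Prop :=
  ComputablePred (fun w : List (Fin m × Bool) => π (FreeGroup.mk w) = 1)

/-- A group is finitely presented: quotient of a finite-rank free group by the
normal closure of finitely many relators. -/
def IsFinitelyPresented (K : Type*) [Group K] : Prop :=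
  ∃ (m : ℕ) (π : FreeGroup (Fin m) →* K) (R : Finset (FreeGroup (Fin m))),
    Function.Surjective π ∧ π.ker = Subgroup.normalClosure (R : Set (FreeGroup (Fin m)))


namespace IFE

/-! ### Generic lemmas: left orders from actions, word length -/

theorem leftOrderable_of_action {K Ω : Type*} [Group K] [LinearOrder Ω]
    (act : K →* Equiv.Perm Ω) (hinj : Function.Injective act)
    (hmono : ∀ k, StrictMono (act k)) : IsLeftOrderable K := by
  classical
  let r : Ω → Ω → Prop := WellOrderingRel
  have wo : IsWellOrder Ω r := inferInstanceAs (IsWellOrder Ω WellOrderingRel)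
  let φ : K → (Ω → Ω) := fun k x => act k x
  have hφ : Function.Injective φ := by
    intro a b h
    apply hinj
    ext x
    exact congrFun h x
  -- lexicographic order
  let lt : K → K → Prop := fun a b => ∃ x, (∀ y, r y x → φ a y = φ b y) ∧ φ a x < φ b x
  have hmin : ∀ a b, a ≠ b → ∃ x, (∀ y, r y x → φ a y = φ b y) ∧ φ a x ≠ φ b x := by
    intro a b hab
    have hne : ({x | φ a x ≠ φ b x} : Set Ω).Nonempty := by
      by_contra h
      apply hab
      apply hφ
      funext x
      by_contra hx
      exact h ⟨x, hx⟩
    refine ⟨wo.wf.min _ hne, ?_, wo.wf.min_mem _ hne⟩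
    intro y hy
    by_contra h
    exact wo.wf.not_lt_min _ (x := y) h hy
  have irr : ∀ a, ¬ lt a a := fun a ⟨x, _, h⟩ => lt_irrefl _ h
  have tr : ∀ a b c, lt a b → lt b c → lt a c := by
    rintro a b c ⟨x, hx, hx'⟩ ⟨y, hy, hy'⟩
    rcases trichotomous_of r x y with h | h | h
    · exact ⟨x, fun z hz => (hx z hz).trans (hy z (trans_of r hz h)), by rw [← hy x h]; exact hx'⟩
    · subst h
      exact ⟨x, fun z hz => (hx z hz).trans (hy z hz), hx'.trans hy'⟩
    · exact ⟨y, fun z hz => (hx z (trans_of r hz h)).trans (hy z hz), by rw [hx y h]; exact hy'⟩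
  have tri : ∀ a b, lt a b ∨ a = b ∨ lt b a := by
    intro a b
    by_cases hab : a = b
    · exact Or.inr (Or.inl hab)
    · obtain ⟨x, hx, hne⟩ := hmin a b hab
      rcases lt_or_gt_of_ne hne with h | h
      · exact Or.inl ⟨x, hx, h⟩
      · exact Or.inr (Or.inr ⟨x, fun y hy => (hx y hy).symm, h⟩)
  refine ⟨{ le := fun a b => a = b ∨ lt a b
            lt := lt
            le_refl := fun a => Or.inl rfl
            le_trans := ?_
            le_antisymm := ?_
            le_total := ?_
            lt_iff_le_not_ge := ?_
            toDecidableLE := Classical.decRel _ }, ?_⟩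
  · rintro a b c (rfl | h) (rfl | h')
    · exact Or.inl rfl
    · exact Or.inr h'
    · exact Or.inr h
    · exact Or.inr (tr _ _ _ h h')
  · rintro a b
    constructor
    · intro h
      refine ⟨Or.inr h, ?_⟩
      rintro (rfl | h')
      · exact irr _ h
      · exact irr _ (tr _ _ _ h h')
    · rintro ⟨rfl | h, h'⟩
      · exact absurd (Or.inl rfl) h'
      · exact h
  · rintro a b (rfl | h) (h' | h')
    · rfl
    · rfl
    · exact h'.symm
    · exact absurd (tr _ _ _ h h') (irr _)
  · intro a b
    rcases tri a b with h | h | h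
    · exact Or.inl (Or.inr h)
    · exact Or.inl (Or.inl h)
    · exact Or.inr (Or.inr h)
  · rintro a b c (rfl | ⟨x, hx, hlt⟩)
    · exact Or.inl rfl
    · refine Or.inr ⟨x, ?_, ?_⟩
      · intro y hy
        have := hx y hy
        simp only [φ, map_mul, Equiv.Perm.mul_apply] at this ⊢
        rw [this]
      · simp only [φ, map_mul, Equiv.Perm.mul_apply]
        exact hmono a hlt

section words
variable {G H Ω : Type*} [Group G] [Group H]

theorem exists_word {X : Finset G} (hX : Generates X) (g : G) :
    ∃ w : List G, (∀ a ∈ w, a ∈ X ∨ a⁻¹ ∈ X) ∧ w.prod = g := by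
  have hg : g ∈ Subgroup.closure (X : Set G) := by rw [hX]; trivial
  induction hg using Subgroup.closure_induction with
  | mem x hx => exact ⟨[x], by simpa using Or.inl hx, by simp⟩
  | one => exact ⟨[], by simp, by simp⟩
  | mul x y _ _ hx hy =>
    obtain ⟨w, hw, rfl⟩ := hx
    obtain ⟨w', hw', rfl⟩ := hy
    refine ⟨w ++ w', ?_, by simp⟩
    intro a ha
    rcases List.mem_append.1 ha with h | h
    · exact hw a h
    · exact hw' a h
  | inv x _ hx =>
    obtain ⟨w, hw, rfl⟩ := hx
    refine ⟨(w.map (·⁻¹)).reverse, ?_, by rw [List.prod_inv_reverse]⟩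
    intro a ha
    simp only [List.mem_reverse, List.mem_map] at ha
    obtain ⟨b, hb, rfl⟩ := ha
    rcases hw b hb with h | h
    · right; simpa using h
    · left; exact h

theorem wordLength_le {X : Finset G} (w : List G) (hw : ∀ a ∈ w, a ∈ X ∨ a⁻¹ ∈ X) :
    wordLength X w.prod ≤ w.length :=
  Nat.sInf_le ⟨w, rfl, hw, rfl⟩

theorem exists_geodesic {X : Finset G} (hX : Generates X) (g : G) :
    ∃ w : List G, w.length = wordLength X g ∧ (∀ a ∈ w, a ∈ X ∨ a⁻¹ ∈ X) ∧ w.prod = g := by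
  have : wordLength X g ∈
      {n | ∃ w : List G, w.length = n ∧ (∀ a ∈ w, a ∈ X ∨ a⁻¹ ∈ X) ∧ w.prod = g} := by
    apply Nat.sInf_mem
    obtain ⟨w, hw, hw'⟩ := exists_word hX g
    exact ⟨w.length, w, rfl, hw, hw'⟩
  exact this

/-- A cocycle (germ) argument producing isometric Frattini embeddings. -/
theorem cocycle_embedding {X : Finset G} {Y : Finset H} (hX : Generates X) (hY : Generates Y)
    (φ : G →* H) (hφ : ∀ x ∈ X, φ x ∈ Y) (act : H →* Equiv.Perm Ω) (Germ : H → Ω → G → Prop)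
    (uniq : ∀ h x a b, Germ h x a → Germ h x b → a = b)
    (mul : ∀ h k x a b, Germ h (act k x) a → Germ k x b → Germ (h * k) x (a * b))
    (one : ∀ x, Germ 1 x 1)
    (inv : ∀ h x a, Germ h x a → Germ h⁻¹ (act h x) a⁻¹)
    (letter : ∀ y ∈ Y, ∀ x, ∃ a, Germ y x a ∧ (a = 1 ∨ a ∈ X))
    (x0 : Ω) (fix : ∀ g h a, Germ h x0 a → Germ h (act (φ g) x0) a) (base : ∀ g, Germ (φ g) x0 g)
    (dich : ∀ g x, Germ (φ g) x 1 ∨ Germ (φ g) x g) :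
    IsFrattini φ ∧ ∀ g, wordLength Y (φ g) = wordLength X g := by
  have letter' : ∀ y, (y ∈ Y ∨ y⁻¹ ∈ Y) → ∀ x, ∃ a, Germ y x a ∧ (a = 1 ∨ a ∈ X ∨ a⁻¹ ∈ X) := by
    rintro y (hy | hy) x
    · obtain ⟨a, ha, h | h⟩ := letter y hy x
      · exact ⟨a, ha, Or.inl h⟩
      · exact ⟨a, ha, Or.inr (Or.inl h)⟩
    · obtain ⟨a, ha, h⟩ := letter _ hy (act y x)
      refine ⟨a⁻¹, ?_, ?_⟩
      · have := inv _ _ _ ha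
        simpa using this
      · rcases h with h | h
        · left; simp [h]
        · right; right; simpa using h
  have words : ∀ w : List H, (∀ a ∈ w, a ∈ Y ∨ a⁻¹ ∈ Y) → ∀ x, ∃ v : List G,
      v.length ≤ w.length ∧ (∀ a ∈ v, a ∈ X ∨ a⁻¹ ∈ X) ∧ Germ w.prod x v.prod := by
    intro w
    induction w with
    | nil => exact fun _ x => ⟨[], by simp, by simp, by simpa using one x⟩
    | cons y w ih =>
      intro hw x
      obtain ⟨v, hv1, hv2, hv3⟩ := ih (fun a ha => hw a (List.mem_cons_of_mem _ ha)) x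
      obtain ⟨a, ha, h⟩ := letter' y (hw y List.mem_cons_self) (act w.prod x)
      have hm := mul _ _ _ _ _ ha hv3
      rcases h with h | h
      · refine ⟨v, by simp; omega, hv2, ?_⟩
        subst h
        simpa using hm
      · refine ⟨a :: v, by simpa using hv1, ?_, by simpa using hm⟩
        intro b hb
        rcases List.mem_cons.1 hb with rfl | hb
        · exact h
        · exact hv2 b hb
  have hinj : Function.Injective φ := by
    intro a b hab
    have h1 := base a
    rw [hab] at h1
    exact uniq _ _ _ _ h1 (base b)
  refine ⟨⟨hinj, fun a b => ⟨fun h => φ.map_isConj h, ?_⟩⟩, ?_⟩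
  · intro h
    obtain ⟨c, hc⟩ := isConj_iff.1 h
    obtain ⟨w, hw, rfl⟩ := exists_word hY c
    obtain ⟨v, -, -, hv⟩ := words w hw x0
    have h1 : Germ (w.prod * φ a * w.prod⁻¹) (act w.prod x0) (v.prod * a * v.prod⁻¹) := by
      apply mul _ _ _ _ _ _ (inv _ _ _ hv)
      have : act w.prod⁻¹ (act w.prod x0) = x0 := by simp
      rw [this]
      apply mul _ _ _ _ _ _ (base a)
      exact fix _ _ _ hv
    rw [hc] at h1
    rcases dich b (act w.prod x0) with h2 | h2
    · have h3 := uniq _ _ _ _ h1 h2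
      have ha : a = 1 := by
        have : v.prod * a = v.prod := by simpa [mul_inv_eq_iff_eq_mul] using h3
        simpa using this
      subst ha
      have : b = 1 := by
        apply hinj
        rw [← hc]; simp
      rw [this]
    · exact isConj_iff.2 ⟨v.prod, uniq _ _ _ _ h1 h2⟩
  · intro g
    apply le_antisymm
    · obtain ⟨w, hw1, hw2, hw3⟩ := exists_geodesic hX g
      rw [← hw1]
      have h := wordLength_le (X := Y) (w.map φ) (by
        intro a ha
        obtain ⟨b, hb, rfl⟩ := List.mem_map.1 ha
        rcases hw2 b hb with h | h
        · exact Or.inl (hφ _ h)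
        · right; rw [← map_inv]; exact hφ _ h)
      rw [← map_list_prod, hw3] at h
      simpa using h
    · obtain ⟨w, hw1, hw2, hw3⟩ := exists_geodesic hY (φ g)
      obtain ⟨v, hv1, hv2, hv3⟩ := words w hw2 x0
      rw [hw3] at hv3
      have := uniq _ _ _ _ hv3 (base g)
      rw [← hw1, ← this]
      exact (wordLength_le v hv2).trans hv1

theorem IsFrattini.comp' {K : Type*} [Group K] {φ : G →* H} {ψ : H →* K}
    (h1 : IsFrattini φ) (h2 : IsFrattini ψ) : IsFrattini (ψ.comp φ) :=
  ⟨h2.1.comp h1.1, fun a b => (h1.2 a b).trans (h2.2 _ _)⟩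

theorem countable_of_generates {X : Finset G} (hX : Generates X) : Countable G := by
  have : Function.Surjective (fun w : List {a : G // a ∈ X ∨ a⁻¹ ∈ X} =>
      (w.map Subtype.val).prod) := by
    intro g
    obtain ⟨w, hw, rfl⟩ := exists_word hX g
    refine ⟨w.attach.map (fun a => ⟨a.1, hw _ a.2⟩), ?_⟩
    simp [Function.comp_def]
  have hf : Finite {a : G // a ∈ X ∨ a⁻¹ ∈ X} := by
    have h : {a : G | a ∈ X ∨ a⁻¹ ∈ X}.Finite := by
      have : {a : G | a ∈ X ∨ a⁻¹ ∈ X} = (X : Set G) ∪ (X : Set G)⁻¹ := by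
        ext; simp
      rw [this]
      exact X.finite_toSet.union X.finite_toSet.inv
    exact h
  exact this.countable

theorem finset_generates (Y0 : Set G) (hf : Y0.Finite) :
    ∃ Y : Finset (Subgroup.closure Y0), Generates Y ∧ ∀ y, y ∈ Y ↔ (y : G) ∈ Y0 := by
  have hfin : ((Subtype.val : Subgroup.closure Y0 → G) ⁻¹' Y0).Finite :=
    hf.preimage Subtype.val_injective.injOn
  refine ⟨hfin.toFinset, ?_, fun y => by simp⟩
  unfold Generates
  rw [Set.Finite.coe_toFinset]
  exact Subgroup.closure_closure_coe_preimage

end words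

end IFE


namespace IFE

/-! ### The dyadic line -/

/-- The ring of dyadic rationals. -/
def dyadic : Subring ℚ where
  carrier := {q | ∃ n : ℕ, ∃ m : ℤ, q * 2 ^ n = m}
  mul_mem' := by
    rintro a b ⟨n, m, h⟩ ⟨n', m', h'⟩
    refine ⟨n + n', m * m', ?_⟩
    push_cast
    rw [← h, ← h']
    ring
  one_mem' := ⟨0, 1, by simp⟩
  add_mem' := by
    rintro a b ⟨n, m, h⟩ ⟨n', m', h'⟩
    refine ⟨n + n', m * 2 ^ n' + m' * 2 ^ n, ?_⟩
    push_cast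
    rw [← h, ← h']
    ring
  zero_mem' := ⟨0, 0, by simp⟩
  neg_mem' := by
    rintro a ⟨n, m, h⟩
    exact ⟨n, -m, by push_cast; rw [← h]; ring⟩

abbrev D : Type := ↥dyadic

theorem half_mem {q : ℚ} (h : q ∈ dyadic) : q / 2 ∈ dyadic := by
  obtain ⟨n, m, h⟩ := h
  refine ⟨n + 1, m, ?_⟩
  rw [← h]; ring

theorem int_mem (k : ℤ) : (k : ℚ) ∈ dyadic := intCast_mem dyadic k

theorem two_pow_mem (k : ℕ) : (1 / 2 ^ k : ℚ) ∈ dyadic := ⟨k, 1, by simp⟩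

theorem two_zpow_mem (k : ℤ) : (2 ^ k : ℚ) ∈ dyadic := by
  obtain ⟨n, rfl | rfl⟩ := k.eq_nat_or_neg
  · exact ⟨0, 2 ^ n, by simp⟩
  · have := two_pow_mem n
    simpa using this

theorem D.countable : Countable D := inferInstance

theorem exists_dyadic_lt {δ : ℚ} (h : 0 < δ) : ∃ k : ℕ, (1 / 2 ^ k : ℚ) < δ := by
  obtain ⟨k, hk⟩ := exists_pow_lt_of_lt_one h (by norm_num : (1 / 2 : ℚ) < 1)
  exact ⟨k, by simpa using hk⟩

theorem dyadic_between {a b : ℚ} (h : a < b) : ∃ x : D, a < x ∧ (x : ℚ) < b := by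
  obtain ⟨k, hk⟩ := exists_dyadic_lt (sub_pos.2 h)
  have hp : (0 : ℚ) < 2 ^ k := by positivity
  have hm : ((⌊a * 2 ^ k⌋ + 1 : ℤ) : ℚ) * (1 / 2 ^ k) ∈ dyadic :=
    dyadic.mul_mem (int_mem _) (two_pow_mem k)
  have h1 := Int.lt_floor_add_one (a * 2 ^ k)
  have h2 := Int.floor_le (a * 2 ^ k)
  have hk' : 1 < (b - a) * 2 ^ k := by
    rwa [div_lt_iff₀ hp] at hk
  refine ⟨⟨_, hm⟩, ?_, ?_⟩
  · show a < ((⌊a * 2 ^ k⌋ + 1 : ℤ) : ℚ) * (1 / 2 ^ k)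
    rw [mul_one_div, lt_div_iff₀ hp]
    push_cast
    exact h1
  · show ((⌊a * 2 ^ k⌋ + 1 : ℤ) : ℚ) * (1 / 2 ^ k) < b
    rw [mul_one_div, div_lt_iff₀ hp]
    push_cast
    linarith

/-- translation by an integer -/
def tr (k : ℤ) : Equiv.Perm D := Equiv.addRight (k : D)

@[simp] theorem tr_apply (k : ℤ) (x : D) : tr k x = x + (k : D) := rfl

theorem tr_coe (k : ℤ) (x : D) : ((tr k x : D) : ℚ) = x + k := by simp

theorem tr_mul (j k : ℤ) : tr j * tr k = tr (j + k) := by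
  ext x
  simp
  ring

theorem tr_tr (j k : ℤ) (x : D) : tr j (tr k x) = tr (j + k) x := by
  rw [← tr_mul]; rfl

theorem tr_zero : tr 0 = 1 := by
  ext x; simp

theorem tr_solve {j k : ℤ} {a z : D} (h : tr (6 * k) a = tr (6 * j) z) :
    z = tr (6 * (k - j)) a := by
  have : tr (6 * (-j)) (tr (6 * k) a) = tr (6 * (-j)) (tr (6 * j) z) := by rw [h]
  rw [tr_tr, tr_tr, show 6 * (-j) + 6 * j = 0 by ring, tr_zero] at this
  rw [show 6 * (k - j) = 6 * (-j) + 6 * k by ring, this]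
  rfl

theorem tr_inv (k : ℤ) : (tr k)⁻¹ = tr (-k) := by
  rw [inv_eq_iff_mul_eq_one, tr_mul]; simp [tr_zero]

def σ : Equiv.Perm D := tr 1

theorem σ_zpow (k : ℤ) : σ ^ k = tr k := by
  induction k using Int.induction_on with
  | zero => simp [tr_zero]
  | succ n ih => rw [zpow_add_one, ih, σ, tr_mul]
  | pred n ih => rw [zpow_sub_one, ih, σ, tr_inv, tr_mul]; rfl

theorem tr_strictMono (k : ℤ) : StrictMono (tr k) := by
  intro x y h
  simpa using h

theorem strictMono_inv {Ω : Type*} [LinearOrder Ω] {p : Equiv.Perm Ω} (h : StrictMono p) :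
    StrictMono (p⁻¹ : Equiv.Perm Ω) := by
  intro x y hxy
  by_contra hc
  have := h.monotone (not_lt.1 hc)
  simp at this
  exact absurd hxy (not_lt.2 this)

theorem strictMono_mul {Ω : Type*} [LinearOrder Ω] {p q : Equiv.Perm Ω} (h : StrictMono p)
    (h' : StrictMono q) : StrictMono (p * q : Equiv.Perm Ω) := h.comp h'

/-- Monotone permutations of an order. -/
def monoPerm (Ω : Type*) [LinearOrder Ω] : Subgroup (Equiv.Perm Ω) where
  carrier := {p | StrictMono p}
  mul_mem' := strictMono_mul
  one_mem' := strictMono_id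
  inv_mem' := strictMono_inv

/-! ### Blocks -/

def blk (x : D) : ℤ := ⌊((x : ℚ) + 1) / 6⌋

theorem blk_le (x : D) : -1 + 6 * (blk x : ℚ) ≤ x := by
  have := Int.floor_le (((x : ℚ) + 1) / 6)
  change (blk x : ℚ) ≤ _ at this
  linarith

theorem lt_blk (x : D) : (x : ℚ) < 5 + 6 * (blk x : ℚ) := by
  have := Int.lt_floor_add_one (((x : ℚ) + 1) / 6)
  change _ < (blk x : ℚ) + 1 at this
  linarith

theorem blk_eq {x : D} {k : ℤ} (h1 : -1 + 6 * (k : ℚ) ≤ x) (h2 : (x : ℚ) < 5 + 6 * (k : ℚ)) :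
    blk x = k := by
  rw [blk, Int.floor_eq_iff]
  constructor <;> linarith

theorem blk_tr (x : D) (k : ℤ) : blk (tr (6 * k) x) = blk x + k := by
  have h1 := blk_le x
  have h2 := lt_blk x
  apply blk_eq
  · rw [tr_coe]; push_cast; linarith
  · rw [tr_coe]; push_cast; linarith

/-- Monotone permutations supported in the block `[-1,5)`. -/
def Q : Subgroup (Equiv.Perm D) where
  carrier := {p | StrictMono p ∧ ∀ x : D, blk x ≠ 0 → p x = x}
  mul_mem' := by
    rintro a b ⟨h1, h2⟩ ⟨h3, h4⟩
    refine ⟨strictMono_mul h1 h3, fun x hx => ?_⟩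
    simp [h4 x hx, h2 x hx]
  one_mem' := ⟨strictMono_id, fun x _ => rfl⟩
  inv_mem' := by
    rintro a ⟨h1, h2⟩
    refine ⟨strictMono_inv h1, fun x hx => ?_⟩
    rw [Equiv.Perm.inv_eq_iff_eq, h2 x hx]

theorem Q_blk (p : Q) {x : D} (hx : blk x = 0) : blk (p.1 x) = 0 := by
  by_contra h
  have := p.2.2 _ h
  rw [p.1.injective.eq_iff] at this
  rw [this] at h
  exact h hx

/-- The block action. -/
def blFun (F : ℤ → Q) (x : D) : D := tr (6 * blk x) ((F (blk x)).1 (tr (6 * -blk x) x))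

theorem blFun_tr (F : ℤ → Q) {y : D} (hy : blk y = 0) (k : ℤ) :
    blFun F (tr (6 * k) y) = tr (6 * k) ((F k).1 y) := by
  have h : blk (tr (6 * k) y) = k := by rw [blk_tr, hy, zero_add]
  unfold blFun
  rw [h]
  congr 2
  rw [← Equiv.Perm.mul_apply, tr_mul]
  simp [tr_zero]

theorem exists_blk (x : D) : ∃ y k, blk y = 0 ∧ x = tr (6 * k) y := by
  refine ⟨tr (6 * -blk x) x, blk x, by rw [blk_tr]; ring, ?_⟩
  rw [← Equiv.Perm.mul_apply, tr_mul]
  simp [tr_zero]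

theorem blFun_mul (F F' : ℤ → Q) (x : D) : blFun (F * F') x = blFun F (blFun F' x) := by
  obtain ⟨y, k, hy, rfl⟩ := exists_blk x
  rw [blFun_tr _ hy, blFun_tr _ hy, blFun_tr _ (Q_blk _ hy)]
  rfl

theorem blFun_one (x : D) : blFun 1 x = x := by
  obtain ⟨y, k, hy, rfl⟩ := exists_blk x
  rw [blFun_tr _ hy]
  rfl

def bl : (ℤ → Q) →* Equiv.Perm D where
  toFun F := ⟨blFun F, blFun F⁻¹,
    fun x => by rw [← blFun_mul, inv_mul_cancel, blFun_one],
    fun x => by rw [← blFun_mul, mul_inv_cancel, blFun_one]⟩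
  map_one' := by ext x; simp [blFun_one]
  map_mul' F F' := by ext x; simp [blFun_mul]

theorem bl_tr (F : ℤ → Q) {y : D} (hy : blk y = 0) (k : ℤ) :
    bl F (tr (6 * k) y) = tr (6 * k) ((F k).1 y) := blFun_tr F hy k

theorem blk_bl (F : ℤ → Q) (x : D) : blk (bl F x) = blk x := by
  obtain ⟨y, k, hy, rfl⟩ := exists_blk x
  rw [bl_tr _ hy, blk_tr, blk_tr, Q_blk _ hy, hy]

theorem blk_mono {x y : D} (h : x ≤ y) : blk x ≤ blk y := by
  apply Int.floor_le_floor
  have : (x : ℚ) ≤ y := h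
  linarith

theorem lt_of_blk_lt {x y : D} (h : blk x < blk y) : x < y := by
  by_contra hc
  exact absurd h (not_lt.2 (blk_mono (not_lt.1 hc)))

theorem bl_strictMono (F : ℤ → Q) : StrictMono (bl F) := by
  intro x z hxz
  rcases (blk_mono hxz.le).lt_or_eq with h | h
  · apply lt_of_blk_lt
    rwa [blk_bl, blk_bl]
  · obtain ⟨y, k, hy, rfl⟩ := exists_blk x
    obtain ⟨y', k', hy', rfl⟩ := exists_blk z
    rw [blk_tr, blk_tr, hy, hy', zero_add, zero_add] at h
    subst h
    rw [bl_tr _ hy, bl_tr _ hy']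
    apply tr_strictMono
    apply (F k).2.1
    exact (tr_strictMono _).lt_iff_lt.1 hxz

open Classical in
/-- The copy of `p` on the blocks in `C`. -/
noncomputable def pc (C : Set ℤ) : Q →* Equiv.Perm D where
  toFun p := bl (fun k => if k ∈ C then p else 1)
  map_one' := by
    rw [← map_one bl]
    congr 1
    funext k
    simp
  map_mul' p q := by
    rw [← map_mul bl]
    congr 1
    funext k
    by_cases h : k ∈ C <;> simp [h]

theorem pc_strictMono (C : Set ℤ) (p : Q) : StrictMono (pc C p) := bl_strictMono _

theorem pc_mem {C : Set ℤ} (p : Q) {y : D} (hy : blk y = 0) {k : ℤ} (hk : k ∈ C) :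
    pc C p (tr (6 * k) y) = tr (6 * k) (p.1 y) := by
  show bl _ _ = _
  rw [bl_tr _ hy]
  simp [hk]

theorem pc_notMem {C : Set ℤ} (p : Q) {x : D} (hk : blk x ∉ C) :
    pc C p x = x := by
  obtain ⟨y, k, hy, rfl⟩ := exists_blk x
  rw [blk_tr, hy, zero_add] at hk
  show bl _ _ = _
  rw [bl_tr _ hy]
  simp [hk]

/-- commutation with all translations by multiples of six -/
def Per : Subgroup (Equiv.Perm D) where
  carrier := {p | ∀ k x, p (tr (6 * k) x) = tr (6 * k) (p x)}
  mul_mem' := by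
    intro a b ha hb k x
    simp only [Equiv.Perm.mul_apply]
    rw [hb, ha]
  one_mem' := fun k x => rfl
  inv_mem' := by
    intro a ha k x
    rw [Equiv.Perm.inv_eq_iff_eq, ha]
    simp

theorem tr_mem_Per (j : ℤ) : tr j ∈ Per := by
  intro k x
  rw [← Equiv.Perm.mul_apply, ← Equiv.Perm.mul_apply, tr_mul, tr_mul, add_comm]

theorem pc_univ_mem_Per (p : Q) : pc Set.univ p ∈ Per := by
  intro k x
  obtain ⟨y, j, hy, rfl⟩ := exists_blk x
  rw [tr_tr, ← mul_add, pc_mem _ hy (Set.mem_univ _),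
    pc_mem _ hy (Set.mem_univ _), tr_tr, mul_add]

theorem pc_conj {ℓ : Equiv.Perm D} (hℓ : ℓ ∈ Per) {p q : Q} (h : q.1 = ℓ * p.1 * ℓ⁻¹)
    (C : Set ℤ) : ℓ * pc C p * ℓ⁻¹ = pc C q := by
  rw [mul_inv_eq_iff_eq_mul]
  have h' : ∀ x, q.1 (ℓ x) = ℓ (p.1 x) := by intro x; rw [h]; simp
  ext1 x
  simp only [Equiv.Perm.mul_apply]
  obtain ⟨y, k, hy, rfl⟩ := exists_blk x
  by_cases hk : k ∈ C
  · rw [pc_mem _ hy hk, hℓ, hℓ, ← h']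
    by_cases hb : blk (ℓ y) = 0
    · rw [pc_mem _ hb hk]
    · rw [q.2.2 _ hb]
      symm
      obtain ⟨z, j, hz, hzj⟩ := exists_blk (tr (6 * k) (ℓ y))
      rw [hzj]
      by_cases hj : j ∈ C
      · rw [pc_mem _ hz hj]
        congr 1
        have : z = ℓ (tr (6 * (k - j)) y) := by
          rw [hℓ]
          exact tr_solve hzj
        rw [this, h']
        congr 1
        apply p.2.2
        rw [blk_tr, hy, zero_add]
        intro h0
        have hkj : k = j := by omega
        subst hkj
        apply hb
        rw [← (tr (6 * k)).injective hzj] at hz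
        exact hz
      · apply pc_notMem
        rwa [blk_tr, hz, zero_add]
  · have h1 : pc C p (tr (6 * k) y) = tr (6 * k) y := by
      apply pc_notMem
      rwa [blk_tr, hy, zero_add]
    rw [h1]
    symm
    obtain ⟨z, j, hz, hzj⟩ := exists_blk (ℓ (tr (6 * k) y))
    rw [hzj]
    by_cases hj : j ∈ C
    · rw [pc_mem _ hz hj]
      congr 1
      have : z = ℓ (tr (6 * (k - j)) y) := by
        rw [hℓ] at hzj ⊢
        exact tr_solve hzj
      rw [this, h']
      congr 1
      apply p.2.2
      rw [blk_tr, hy, zero_add]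
      intro h0
      have : k = j := by omega
      subst this
      exact hk hj
    · apply pc_notMem
      rwa [blk_tr, hz, zero_add]

theorem tr_conj_bl (F : ℤ → Q) (j : ℤ) :
    tr (6 * j) * bl F * (tr (6 * j))⁻¹ = bl (fun k => F (k - j)) := by
  rw [mul_inv_eq_iff_eq_mul]
  ext1 x
  obtain ⟨y, k, hy, rfl⟩ := exists_blk x
  simp only [Equiv.Perm.mul_apply]
  rw [bl_tr _ hy, tr_tr, tr_tr, ← mul_add, bl_tr _ hy]
  simp

theorem tr_conj_pc (p : Q) (C : Set ℤ) (j : ℤ) :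
    tr (6 * j) * pc C p * (tr (6 * j))⁻¹ = pc {k | k - j ∈ C} p := tr_conj_bl _ j

end IFE


namespace IFE

/-! ### The basic bump and its relations -/

theorem blk_zero_iff {x : D} : blk x = 0 ↔ -1 ≤ (x : ℚ) ∧ (x : ℚ) < 5 := by
  constructor
  · intro h
    have h1 := blk_le x
    have h2 := lt_blk x
    rw [h] at h1 h2
    norm_num at h1 h2
    exact ⟨h1, h2⟩
  · rintro ⟨h1, h2⟩
    apply blk_eq <;> norm_num <;> assumption

def F0 (q : ℚ) : ℚ :=
  if q < -1 then q else if q < 0 then 2 * q + 1 else if q < 2 then q / 2 + 1 else q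

def F0i (q : ℚ) : ℚ :=
  if q < -1 then q else if q < 1 then (q - 1) / 2 else if q < 2 then 2 * q - 2 else q

theorem F0_mem {q : ℚ} (h : q ∈ dyadic) : F0 q ∈ dyadic := by
  unfold F0
  split_ifs
  · exact h
  · exact dyadic.add_mem (dyadic.mul_mem (by simp) h) dyadic.one_mem
  · exact dyadic.add_mem (half_mem h) dyadic.one_mem
  · exact h

theorem F0i_mem {q : ℚ} (h : q ∈ dyadic) : F0i q ∈ dyadic := by
  unfold F0i
  split_ifs
  · exact h
  · exact half_mem (dyadic.sub_mem h dyadic.one_mem)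
  · exact dyadic.sub_mem (dyadic.mul_mem (by simp) h) (by simp)
  · exact h

theorem F0i_F0 (q : ℚ) : F0i (F0 q) = q := by
  unfold F0 F0i
  split_ifs <;> linarith

theorem F0_F0i (q : ℚ) : F0 (F0i q) = q := by
  unfold F0 F0i
  split_ifs <;> linarith

theorem F0_strictMono : StrictMono F0 := by
  intro a b h
  unfold F0
  split_ifs <;> linarith

def f0 : Q := ⟨⟨fun x => ⟨F0 x, F0_mem x.2⟩, fun x => ⟨F0i x, F0i_mem x.2⟩,
  fun x => Subtype.ext (F0i_F0 _), fun x => Subtype.ext (F0_F0i _)⟩,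
  fun x y h => F0_strictMono h, fun x hx => by
    apply Subtype.ext
    show F0 x = x
    have : (x : ℚ) < -1 ∨ 5 ≤ (x : ℚ) := by
      by_contra hc
      push Not at hc
      exact hx (blk_zero_iff.2 hc)
    unfold F0
    split_ifs <;> first | rfl | (rcases this with h | h <;> linarith)⟩

theorem f0_coe (x : D) : ((f0.1 x : D) : ℚ) = F0 x := rfl

theorem f0i_coe (x : D) : (((f0⁻¹).1 x : D) : ℚ) = F0i x := rfl

/-- The bump on `[1,4)`. -/
def f2 : Q := ⟨tr 2 * f0.1 * (tr 2)⁻¹,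
  strictMono_mul (strictMono_mul (tr_strictMono 2) f0.2.1) (strictMono_inv (tr_strictMono 2)),
  fun x hx => by
    rw [tr_inv]
    apply Subtype.ext
    have : (x : ℚ) < -1 ∨ 5 ≤ (x : ℚ) := by
      by_contra hc
      push Not at hc
      exact hx (blk_zero_iff.2 hc)
    simp only [Equiv.Perm.mul_apply, tr_coe, f0_coe]
    push_cast
    unfold F0
    split_ifs <;> (rcases this with h | h <;> linarith)⟩

theorem f2_coe (x : D) : ((f2.1 x : D) : ℚ) = F0 (x - 2) + 2 := by
  show (((tr 2 * f0.1 * (tr 2)⁻¹) x : D) : ℚ) = _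
  rw [tr_inv]
  simp only [Equiv.Perm.mul_apply, tr_coe, f0_coe]
  push_cast
  rw [sub_eq_add_neg]

theorem f2i_coe (x : D) : (((f2⁻¹).1 x : D) : ℚ) = F0i (x - 2) + 2 := by
  show (((tr 2 * f0.1 * (tr 2)⁻¹)⁻¹ x : D) : ℚ) = _
  rw [mul_inv_rev, mul_inv_rev, inv_inv, tr_inv]
  simp only [Equiv.Perm.mul_apply, tr_coe]
  show F0i (tr (-2) x : D) + _ = _
  rw [tr_coe]
  push_cast
  rw [sub_eq_add_neg]

noncomputable def f : Equiv.Perm D := pc Set.univ f0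

theorem f_apply (x : D) (k : ℤ) (h1 : -1 + 6 * (k : ℚ) ≤ x) (h2 : (x : ℚ) < 5 + 6 * (k : ℚ)) :
    ((f x : D) : ℚ) = F0 (x - 6 * k) + 6 * k := by
  have hb : blk (tr (6 * -k) x) = 0 := by rw [blk_tr, blk_eq h1 h2]; ring
  have hx : x = tr (6 * k) (tr (6 * -k) x) := by rw [tr_tr]; simp
  conv_lhs => rw [hx]
  unfold f
  rw [pc_mem _ hb (Set.mem_univ _), tr_coe, f0_coe, tr_coe]
  push_cast
  congr 2
  ring

theorem fi_apply (x : D) (k : ℤ) (h1 : -1 + 6 * (k : ℚ) ≤ x) (h2 : (x : ℚ) < 5 + 6 * (k : ℚ)) :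
    ((f⁻¹ x : D) : ℚ) = F0i (x - 6 * k) + 6 * k := by
  have hb : blk (tr (6 * -k) x) = 0 := by rw [blk_tr, blk_eq h1 h2]; ring
  have hx : x = tr (6 * k) (tr (6 * -k) x) := by rw [tr_tr]; simp
  conv_lhs => rw [hx]
  unfold f
  rw [← map_inv, pc_mem _ hb (Set.mem_univ _), tr_coe, f0i_coe, tr_coe]
  push_cast
  congr 2
  ring

theorem f_A (x : D) (k : ℤ) (h1 : -1 + 6 * (k : ℚ) ≤ x) (h2 : (x : ℚ) < 6 * (k : ℚ)) :
    ((f x : D) : ℚ) = 2 * x + 1 - 6 * k := by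
  rw [f_apply x k h1 (by linarith)]
  unfold F0
  split_ifs <;> linarith

theorem f_B (x : D) (k : ℤ) (h1 : 6 * (k : ℚ) ≤ x) (h2 : (x : ℚ) < 2 + 6 * (k : ℚ)) :
    ((f x : D) : ℚ) = x / 2 + 1 + 3 * k := by
  rw [f_apply x k (by linarith) (by linarith)]
  unfold F0
  split_ifs <;> linarith

theorem f_C (x : D) (k : ℤ) (h1 : 2 + 6 * (k : ℚ) ≤ x) (h2 : (x : ℚ) < 5 + 6 * (k : ℚ)) :
    ((f x : D) : ℚ) = x := by
  rw [f_apply x k (by linarith) (by linarith)]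
  unfold F0
  split_ifs <;> linarith

theorem fi_A (x : D) (k : ℤ) (h1 : -1 + 6 * (k : ℚ) ≤ x) (h2 : (x : ℚ) < 1 + 6 * (k : ℚ)) :
    ((f⁻¹ x : D) : ℚ) = (x - 1) / 2 + 3 * k := by
  rw [fi_apply x k h1 (by linarith)]
  unfold F0i
  split_ifs <;> linarith

theorem fi_B (x : D) (k : ℤ) (h1 : 1 + 6 * (k : ℚ) ≤ x) (h2 : (x : ℚ) < 2 + 6 * (k : ℚ)) :
    ((f⁻¹ x : D) : ℚ) = 2 * x - 2 - 6 * k := by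
  rw [fi_apply x k (by linarith) (by linarith)]
  unfold F0i
  split_ifs <;> linarith

theorem fi_C (x : D) (k : ℤ) (h1 : 2 + 6 * (k : ℚ) ≤ x) (h2 : (x : ℚ) < 5 + 6 * (k : ℚ)) :
    ((f⁻¹ x : D) : ℚ) = x := by
  rw [fi_apply x k (by linarith) (by linarith)]
  unfold F0i
  split_ifs <;> linarith

theorem σ_coe (x : D) : ((σ x : D) : ℚ) = x + 1 := by simp [σ]

theorem β_A (x : D) (k : ℤ) (h1 : -1 + 6 * (k : ℚ) ≤ x) (h2 : (x : ℚ) < 6 * (k : ℚ)) :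
    (((σ * f) x : D) : ℚ) = 2 * x + 2 - 6 * k := by
  rw [Equiv.Perm.mul_apply, σ_coe, f_A x k h1 h2]; ring

theorem β_B (x : D) (k : ℤ) (h1 : 6 * (k : ℚ) ≤ x) (h2 : (x : ℚ) < 2 + 6 * (k : ℚ)) :
    (((σ * f) x : D) : ℚ) = x / 2 + 2 + 3 * k := by
  rw [Equiv.Perm.mul_apply, σ_coe, f_B x k h1 h2]; ring

theorem β_C (x : D) (k : ℤ) (h1 : 2 + 6 * (k : ℚ) ≤ x) (h2 : (x : ℚ) < 5 + 6 * (k : ℚ)) :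
    (((σ * f) x : D) : ℚ) = x + 1 := by
  rw [Equiv.Perm.mul_apply, σ_coe, f_C x k h1 h2]

theorem rel_σf : (σ * f) ^ 5 = σ ^ 6 := by
  have e6 : σ ^ 6 = tr 6 := by
    have := σ_zpow 6
    exact_mod_cast this
  rw [e6]
  ext1 x
  apply Subtype.ext
  rw [tr_coe]
  set b := σ * f with hb
  have e5 : ∀ y, (b ^ 5) y = b (b (b (b (b y)))) := fun y => by
    simp [pow_succ, Equiv.Perm.mul_apply]
  rw [e5]
  push_cast
  have hA := β_A
  have hB := β_B
  have hC := β_C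
  rw [← hb] at hA hB hC
  have h1 := blk_le x
  have h2 := lt_blk x
  generalize blk x = k at h1 h2
  have hA' := fun y => hA y (k + 1)
  have hB' := fun y => hB y (k + 1)
  have hC' := fun y => hC y (k + 1)
  push_cast at hA' hB' hC'
  by_cases c0 : (x : ℚ) < 6 * k
  · have x1 := hA x k h1 c0
    have x2 := hB (b x) k (by linarith) (by linarith)
    have x3 := hC (b (b x)) k (by linarith) (by linarith)
    have x4 := hC (b (b (b x))) k (by linarith) (by linarith)
    have x5 := hC (b (b (b (b x)))) k (by linarith) (by linarith)
    linarith
  by_cases c1 : (x : ℚ) < 2 + 6 * k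
  · have x1 := hB x k (by linarith) c1
    have x2 := hC (b x) k (by linarith) (by linarith)
    have x3 := hC (b (b x)) k (by linarith) (by linarith)
    have x4 := hC (b (b (b x))) k (by linarith) (by linarith)
    have x5 := hA' (b (b (b (b x)))) (by linarith) (by linarith)
    linarith
  by_cases c2 : (x : ℚ) < 3 + 6 * k
  · have x1 := hC x k (by linarith) (by linarith)
    have x2 := hC (b x) k (by linarith) (by linarith)
    have x3 := hC (b (b x)) k (by linarith) (by linarith)
    have x4 := hA' (b (b (b x))) (by linarith) (by linarith)
    have x5 := hB' (b (b (b (b x)))) (by linarith) (by linarith)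
    linarith
  by_cases c3 : (x : ℚ) < 4 + 6 * k
  · have x1 := hC x k (by linarith) (by linarith)
    have x2 := hC (b x) k (by linarith) (by linarith)
    have x3 := hA' (b (b x)) (by linarith) (by linarith)
    have x4 := hB' (b (b (b x))) (by linarith) (by linarith)
    have x5 := hC' (b (b (b (b x)))) (by linarith) (by linarith)
    linarith
  · have x1 := hC x k (by linarith) (by linarith)
    have x2 := hA' (b x) (by linarith) (by linarith)
    have x3 := hB' (b (b x)) (by linarith) (by linarith)
    have x4 := hC' (b (b (b x))) (by linarith) (by linarith)
    have x5 := hC' (b (b (b (b x)))) (by linarith) (by linarith)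
    linarith

/-- The conjugator `m`. -/
noncomputable def mm : Equiv.Perm D := tr 3 * f⁻¹ * tr (-1) * f⁻¹

theorem mm_A (x : D) (h1 : -1 ≤ (x : ℚ)) (h2 : (x : ℚ) < 1) : ((mm x : D) : ℚ) = (x + 3) / 2 := by
  unfold mm
  simp only [Equiv.Perm.mul_apply]
  have y1 := fi_A x 0 (by norm_num; linarith) (by norm_num; linarith)
  have y2 := tr_coe (-1) (f⁻¹ x)
  push_cast at y1 y2
  have y3 := fi_C (tr (-1) (f⁻¹ x)) (-1) (by push_cast; linarith) (by push_cast; linarith)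
  rw [tr_coe, y3, y2, y1]
  push_cast
  ring

theorem mm_B (x : D) (h1 : 1 ≤ (x : ℚ)) (h2 : (x : ℚ) < 2) : ((mm x : D) : ℚ) = x + 1 := by
  unfold mm
  simp only [Equiv.Perm.mul_apply]
  have y1 := fi_B x 0 (by norm_num; linarith) (by norm_num; linarith)
  have y2 := tr_coe (-1) (f⁻¹ x)
  push_cast at y1 y2
  have y3 := fi_A (tr (-1) (f⁻¹ x)) 0 (by push_cast; linarith) (by push_cast; linarith)
  rw [tr_coe, y3, y2, y1]
  push_cast
  ring

def fstar : Q := f2 * f0 * f2⁻¹ * f0⁻¹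

set_option maxHeartbeats 1000000 in
theorem fstar_coe (x : D) : ((fstar.1 x : D) : ℚ) =
    if (x : ℚ) < 1 then (x : ℚ) else if (x : ℚ) < 3 / 2 then 2 * x - 1
    else if (x : ℚ) < 2 then x + 1 / 2
    else if (x : ℚ) < 3 then x / 2 + 3 / 2 else x := by
  show ((f2.1 (f0.1 ((f2⁻¹).1 ((f0⁻¹).1 x))) : D) : ℚ) = _
  rw [f2_coe, f0_coe, f2i_coe, f0i_coe]
  generalize (x : ℚ) = q
  have h1 : F0i (F0i q - 2) + 2 = if q < -1 then q else if q < 1 then (q - 1) / 2 else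
      if q < 3 / 2 then 2 * q - 2 else if q < 2 then q - 1 / 2 else if q < 3 then (q + 1) / 2 else
      if q < 4 then 2 * q - 4 else q := by
    unfold F0i
    split_ifs <;> linarith
  rw [h1]
  have h2 : F0 (if q < -1 then q else if q < 1 then (q - 1) / 2 else
      if q < 3 / 2 then 2 * q - 2 else if q < 2 then q - 1 / 2 else if q < 3 then (q + 1) / 2 else
      if q < 4 then 2 * q - 4 else q) = if q < 3 / 2 then q else if q < 2 then q / 2 + 3 / 4
      else if q < 3 then q / 4 + 5 / 4 else if q < 4 then 2 * q - 4 else q := by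
    unfold F0
    split_ifs <;> linarith
  rw [h2]
  unfold F0
  split_ifs <;> linarith

theorem mm_f0 : fstar.1 = mm * f0.1 * mm⁻¹ := by
  symm
  rw [mul_inv_eq_iff_eq_mul]
  ext1 x
  simp only [Equiv.Perm.mul_apply]
  apply Subtype.ext
  by_cases hx : -1 ≤ (x : ℚ) ∧ (x : ℚ) < 2
  · obtain ⟨h1, h2⟩ := hx
    have hf := f0_coe x
    rw [fstar_coe]
    unfold F0 at hf
    by_cases c0 : (x : ℚ) < 0
    · have e1 : ((f0.1 x : D) : ℚ) = 2 * x + 1 := by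
        rw [hf]; split_ifs <;> linarith
      rw [mm_A x h1 (by linarith), mm_A _ (by linarith) (by linarith), e1]
      split_ifs <;> linarith
    · have e1 : ((f0.1 x : D) : ℚ) = x / 2 + 1 := by
        rw [hf]; split_ifs <;> linarith
      rw [mm_B _ (by linarith) (by linarith), e1]
      by_cases c1 : (x : ℚ) < 1
      · rw [mm_A x h1 (by linarith)]
        split_ifs <;> linarith
      · rw [mm_B x (by linarith) (by linarith)]
        split_ifs <;> linarith
  · have e1 : f0.1 x = x := by
      apply Subtype.ext
      rw [f0_coe]
      unfold F0
      by_contra hc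
      apply hx
      split_ifs at hc <;> first | exact absurd rfl hc | exact ⟨by linarith, by linarith⟩
    rw [e1, fstar_coe]
    have hm : ¬ (1 ≤ ((mm x : D) : ℚ) ∧ ((mm x : D) : ℚ) < 3) := by
      rintro ⟨h1, h2⟩
      have hmem : ∃ z : D, (-1 ≤ (z : ℚ) ∧ (z : ℚ) < 2) ∧ mm z = mm x := by
        by_cases c : ((mm x : D) : ℚ) < 2
        · refine ⟨mm x + mm x - 1 - 1 - 1, ?_, ?_⟩
          · push_cast
            exact ⟨by linarith, by linarith⟩
          · apply Subtype.ext
            rw [mm_A _ (by push_cast; linarith) (by push_cast; linarith)]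
            push_cast
            ring
        · refine ⟨mm x - 1, ?_, ?_⟩
          · push_cast
            exact ⟨by linarith, by linarith⟩
          · apply Subtype.ext
            rw [mm_B _ (by push_cast; linarith) (by push_cast; linarith)]
            push_cast
            ring
      obtain ⟨z, hz, hzx⟩ := hmem
      rw [mm.injective hzx] at hz
      exact hx hz
    have hm' : ((mm x : D) : ℚ) < 1 ∨ 3 ≤ ((mm x : D) : ℚ) := by
      by_contra hc
      push Not at hc
      exact hm hc
    split_ifs <;> rcases hm' with h | h <;> linarith

end IFE


namespace IFE

/-! ### The group generated by `σ` and `f`; mobility -/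

def LL : Subgroup (Equiv.Perm D) := Subgroup.closure {σ, f}

theorem σ_mem_LL : σ ∈ LL := Subgroup.subset_closure (by simp)

theorem f_mem_LL : f ∈ LL := Subgroup.subset_closure (by simp)

theorem tr_mem_LL (k : ℤ) : tr k ∈ LL := by
  rw [← σ_zpow]; exact LL.zpow_mem σ_mem_LL k

theorem mm_mem_LL : mm ∈ LL :=
  LL.mul_mem (LL.mul_mem (LL.mul_mem (tr_mem_LL 3) (LL.inv_mem f_mem_LL)) (tr_mem_LL (-1)))
    (LL.inv_mem f_mem_LL)

theorem LL_le_Per : LL ≤ Per := by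
  unfold LL
  rw [Subgroup.closure_le]
  rintro x (rfl | rfl)
  · exact tr_mem_Per 1
  · exact pc_univ_mem_Per f0

theorem LL_le_mono : LL ≤ monoPerm D := by
  unfold LL
  rw [Subgroup.closure_le]
  rintro x (rfl | rfl)
  · exact tr_strictMono 1
  · exact pc_strictMono _ f0

theorem mm_conj (C : Set ℤ) : mm * pc C f0 * mm⁻¹ = pc C fstar :=
  pc_conj (LL_le_Per mm_mem_LL) mm_f0 C

theorem tr2_conj (C : Set ℤ) : tr 2 * pc C f0 * (tr 2)⁻¹ = pc C f2 :=
  pc_conj (tr_mem_Per 2) rfl C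

theorem σ_mem_of_normal {K : Type*} [Group K] (N : Subgroup K) [N.Normal] {s g : K}
    (hrel : (s * g) ^ 5 = s ^ 6) (hg : g ∈ N) : s ∈ N := by
  have hg' : (g : K ⧸ N) = 1 := (QuotientGroup.eq_one_iff g).2 hg
  have h : (((s * g) ^ 5 : K) : K ⧸ N) = ((s ^ 6 : K) : K ⧸ N) := by rw [hrel]
  rw [← QuotientGroup.eq_one_iff]
  simp only [QuotientGroup.mk_pow, QuotientGroup.mk_mul, hg', mul_one] at h
  rw [pow_succ _ 5] at h
  exact (left_eq_mul.1 h)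

theorem mobile_aux (k : ℕ) (x : ℚ) (h0 : 0 ≤ x) (h2 : x < 2) : ∃ ℓ ∈ LL, ∃ d : ℚ,
    (∀ y : D, 0 ≤ (y : ℚ) → (y : ℚ) < 2 → ((ℓ y : D) : ℚ) = y / 2 ^ k + d) ∧
    d ≤ x ∧ x < d + 2 / 2 ^ k := by
  induction k with
  | zero => exact ⟨1, LL.one_mem, 0, fun y _ _ => by simp, h0, by simpa using h2⟩
  | succ k ih =>
    obtain ⟨ℓ, hℓ, d, hd, h3, h4⟩ := ih
    have hp : (0 : ℚ) < 2 ^ k := by positivity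
    have hfy : ∀ y : D, 0 ≤ (y : ℚ) → (y : ℚ) < 2 → ((f y : D) : ℚ) = y / 2 + 1 := by
      intro y hy1 hy2
      have := f_B y 0 (by push_cast; linarith) (by push_cast; linarith)
      rw [this]; push_cast; ring
    by_cases hc : x < d + 1 / 2 ^ k
    · refine ⟨ℓ * (tr (-1) * f), LL.mul_mem hℓ (LL.mul_mem (tr_mem_LL _) f_mem_LL), d, ?_, h3, ?_⟩
      · intro y hy1 hy2
        have e : ((tr (-1) (f y) : D) : ℚ) = y / 2 := by
          rw [tr_coe, hfy y hy1 hy2]; push_cast; ring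
        simp only [Equiv.Perm.mul_apply]
        rw [hd _ (by linarith) (by linarith), e, pow_succ]
        field_simp
      · rw [pow_succ]
        have : (2 : ℚ) / (2 ^ k * 2) = 1 / 2 ^ k := by field_simp
        rwa [this]
    · refine ⟨ℓ * f, LL.mul_mem hℓ f_mem_LL, d + 1 / 2 ^ k, ?_, by linarith, ?_⟩
      · intro y hy1 hy2
        have e := hfy y hy1 hy2
        simp only [Equiv.Perm.mul_apply]
        rw [hd _ (by linarith) (by linarith), e, pow_succ]
        field_simp
        ring
      · rw [pow_succ]
        have : (2 : ℚ) / (2 ^ k * 2) = 1 / 2 ^ k := by field_simp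
        have h' : (2 : ℚ) / 2 ^ k = 1 / 2 ^ k + 1 / 2 ^ k := by ring
        rw [this]
        linarith

noncomputable def ee : Equiv.Perm D :=
  (tr 1 * f * tr (-1)) * f * (tr (-1) * f * tr 1) * (tr (-1) * f * tr 1)

theorem ee_mem : ee ∈ LL := by
  unfold ee
  have h1 := f_mem_LL
  have h2 := tr_mem_LL 1
  have h3 := tr_mem_LL (-1)
  exact LL.mul_mem (LL.mul_mem (LL.mul_mem (LL.mul_mem (LL.mul_mem h2 h1) h3) h1)
    (LL.mul_mem (LL.mul_mem h3 h1) h2)) (LL.mul_mem (LL.mul_mem h3 h1) h2)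

theorem ee_neg_one : 2 ≤ ((ee (-1) : D) : ℚ) := by
  unfold ee
  simp only [Equiv.Perm.mul_apply]
  have y1 := tr_coe 1 (-1)
  set a1 := tr 1 (-1)
  push_cast at y1
  have y2 := f_B a1 0 (by push_cast; linarith) (by push_cast; linarith)
  set a2 := f a1
  have y3 := tr_coe (-1) a2
  set a3 := tr (-1) a2
  have y4 := tr_coe 1 a3
  set a4 := tr 1 a3
  push_cast at y1 y2 y3 y4
  have y5 := f_B a4 0 (by push_cast; linarith) (by push_cast; linarith)
  set a5 := f a4
  have y6 := tr_coe (-1) a5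
  set a6 := tr (-1) a5
  push_cast at y5 y6
  have y7 := f_B a6 0 (by push_cast; linarith) (by push_cast; linarith)
  set a7 := f a6
  have y8 := tr_coe (-1) a7
  set a8 := tr (-1) a7
  push_cast at y7 y8
  have y9 := f_B a8 0 (by push_cast; linarith) (by push_cast; linarith)
  set a9 := f a8
  have y10 := tr_coe 1 a9
  push_cast at y9 y10
  linarith

theorem ee_four : ((ee ((4 : ℤ) : D) : D) : ℚ) = 4 := by
  unfold ee
  simp only [Equiv.Perm.mul_apply]
  have y1 := tr_coe 1 ((4 : ℤ) : D)
  set a1 := tr 1 ((4 : ℤ) : D)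
  have h4 : (((4 : ℤ) : D) : ℚ) = 4 := by push_cast; rfl
  rw [h4] at y1
  push_cast at y1
  have y2 := f_A a1 1 (by push_cast; linarith) (by push_cast; linarith)
  set a2 := f a1
  have y3 := tr_coe (-1) a2
  set a3 := tr (-1) a2
  have y4 := tr_coe 1 a3
  set a4 := tr 1 a3
  push_cast at y1 y2 y3 y4
  have y5 := f_A a4 1 (by push_cast; linarith) (by push_cast; linarith)
  set a5 := f a4
  have y6 := tr_coe (-1) a5
  set a6 := tr (-1) a5
  push_cast at y5 y6
  have y7 := f_C a6 0 (by push_cast; linarith) (by push_cast; linarith)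
  set a7 := f a6
  have y8 := tr_coe (-1) a7
  set a8 := tr (-1) a7
  push_cast at y7 y8
  have y9 := f_C a8 0 (by push_cast; linarith) (by push_cast; linarith)
  set a9 := f a8
  have y10 := tr_coe 1 a9
  push_cast at y9 y10
  linarith

theorem mobile (x : D) {δ : ℚ} (hδ : 0 < δ) : ∃ ℓ ∈ LL, ∀ y : D, -1 ≤ (y : ℚ) → (y : ℚ) < 4 →
    (x : ℚ) ≤ (ℓ y : D) ∧ ((ℓ y : D) : ℚ) < x + δ := by
  set j := ⌊(x : ℚ)⌋ with hj
  have j1 := Int.floor_le (x : ℚ)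
  have j2 := Int.lt_floor_add_one (x : ℚ)
  rw [← hj] at j1 j2
  set ε := min δ 1 with hε
  have e1 : 0 < ε := lt_min hδ one_pos
  have e2 : ε ≤ 1 := min_le_right _ _
  have e3 : ε ≤ δ := min_le_left _ _
  obtain ⟨k, hk⟩ := exists_dyadic_lt (show 0 < ε / 4 by linarith)
  obtain ⟨ℓ, hℓ, d, hd, h1, h2⟩ := mobile_aux k (x - j + ε / 2) (by linarith) (by linarith)
  refine ⟨tr j * ℓ * (tr (-2) * ee), LL.mul_mem (LL.mul_mem (tr_mem_LL _) hℓ)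
    (LL.mul_mem (tr_mem_LL _) ee_mem), fun y hy1 hy2 => ?_⟩
  have hem := LL_le_mono ee_mem
  have h4 : (((4 : ℤ) : D) : ℚ) = 4 := by push_cast; rfl
  have b1 : (2 : ℚ) ≤ (ee y : D) := by
    refine ee_neg_one.trans ?_
    have : ee (-1) ≤ ee y := StrictMono.monotone hem (show ((-1 : D) : ℚ) ≤ y by push_cast; exact hy1)
    exact this
  have b2 : ((ee y : D) : ℚ) < 4 := by
    rw [← ee_four]
    have : ee y < ee ((4 : ℤ) : D) := hem (show (y : ℚ) < (((4 : ℤ) : D) : ℚ) by rw [h4]; exact hy2)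
    exact this
  simp only [Equiv.Perm.mul_apply]
  have c := tr_coe (-2) (ee y)
  set z := tr (-2) (ee y)
  push_cast at c
  have hz := hd z (by linarith) (by linarith)
  rw [tr_coe, hz]
  have hp : (0 : ℚ) < 2 ^ k := by positivity
  have g1 : 0 ≤ (z : ℚ) / 2 ^ k := div_nonneg (by linarith) hp.le
  have g2 : (z : ℚ) / 2 ^ k < 2 / 2 ^ k := by
    apply div_lt_div_of_pos_right _ hp; linarith
  have g3 : (2 : ℚ) / 2 ^ k = 2 * (1 / 2 ^ k) := by ring
  constructor <;> linarith

end IFE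


namespace IFE

open scoped commutatorElement

/-! ### Stage 1: embedding into a perfect group -/

def VV : Set D := {x | 6 * (blk x : ℚ) ≤ x ∧ (x : ℚ) < 2 + 6 * (blk x : ℚ)}

theorem VV_iff {x : D} (k : ℤ) (h1 : -1 + 6 * (k : ℚ) ≤ x) (h2 : (x : ℚ) < 5 + 6 * (k : ℚ)) :
    x ∈ VV ↔ 6 * (k : ℚ) ≤ x ∧ (x : ℚ) < 2 + 6 * (k : ℚ) := by
  unfold VV
  rw [Set.mem_ofPred_eq, blk_eq h1 h2]

theorem VV_split (x : D) : (x ∈ VV ∧ f⁻¹ x ∈ VV ∧ f⁻¹ (σ x) ∉ VV) ∨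
    (x ∈ VV ∧ f⁻¹ x ∉ VV ∧ f⁻¹ (σ x) ∈ VV) ∨ (x ∉ VV ∧ f⁻¹ x ∉ VV ∧ f⁻¹ (σ x) ∉ VV) := by
  have h1 := blk_le x
  have h2 := lt_blk x
  generalize blk x = k at h1 h2
  have hσ := σ_coe x
  by_cases c0 : (x : ℚ) < 6 * k
  · have e1 := fi_A x k h1 (by linarith)
    have e2 := fi_A (σ x) k (by linarith) (by linarith)
    rw [VV_iff k h1 h2, VV_iff (x := f⁻¹ x) k (by linarith) (by linarith),
      VV_iff (x := f⁻¹ (σ x)) k (by linarith) (by linarith)]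
    right; right
    exact ⟨fun h => by linarith [h.1, h.2], fun h => by linarith [h.1, h.2],
      fun h => by linarith [h.1, h.2]⟩
  by_cases c1 : (x : ℚ) < 1 + 6 * k
  · have e1 := fi_A x k h1 (by linarith)
    have e2 := fi_B (σ x) k (by linarith) (by linarith)
    rw [VV_iff k h1 h2, VV_iff (x := f⁻¹ x) k (by linarith) (by linarith),
      VV_iff (x := f⁻¹ (σ x)) k (by linarith) (by linarith)]
    right; left
    exact ⟨⟨by linarith, by linarith⟩, fun h => by linarith [h.1, h.2],
      ⟨by linarith, by linarith⟩⟩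
  by_cases c2 : (x : ℚ) < 2 + 6 * k
  · have e1 := fi_B x k (by linarith) (by linarith)
    have e2 := fi_C (σ x) k (by linarith) (by linarith)
    rw [VV_iff k h1 h2, VV_iff (x := f⁻¹ x) k (by linarith) (by linarith),
      VV_iff (x := f⁻¹ (σ x)) k (by linarith) (by linarith)]
    left
    exact ⟨⟨by linarith, by linarith⟩, ⟨by linarith, by linarith⟩,
      fun h => by linarith [h.1, h.2]⟩
  by_cases c3 : (x : ℚ) < 4 + 6 * k
  · have e1 := fi_C x k (by linarith) (by linarith)
    have e2 := fi_C (σ x) k (by linarith) (by linarith)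
    rw [VV_iff k h1 h2, VV_iff (x := f⁻¹ x) k (by linarith) (by linarith),
      VV_iff (x := f⁻¹ (σ x)) k (by linarith) (by linarith)]
    right; right
    exact ⟨fun h => by linarith [h.1, h.2], fun h => by linarith [h.1, h.2],
      fun h => by linarith [h.1, h.2]⟩
  · have e1 := fi_C x k (by linarith) (by linarith)
    have e2 := fi_A (σ x) (k + 1) (by push_cast; linarith) (by push_cast; linarith)
    push_cast at e2
    rw [VV_iff k h1 h2, VV_iff (x := f⁻¹ x) k (by linarith) (by linarith),
      VV_iff (x := f⁻¹ (σ x)) (k + 1) (by push_cast; linarith) (by push_cast; linarith)]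
    right; right
    push_cast
    exact ⟨fun h => by linarith [h.1, h.2], fun h => by linarith [h.1, h.2],
      fun h => by linarith [h.1, h.2]⟩

theorem perm_apply_inv {Ω : Type*} (p : Equiv.Perm Ω) (x : Ω) : p (p⁻¹ x) = x :=
  p.apply_symm_apply x

theorem perm_inv_apply {Ω : Type*} (p : Equiv.Perm Ω) (x : Ω) : p⁻¹ (p x) = x :=
  p.symm_apply_apply x

section stage1
variable (G : Type) [Group G]

/-- lift of a permutation of the line -/
def lft : Equiv.Perm D →* Equiv.Perm (Lex (D × G)) where
  toFun p := ⟨fun z => toLex (p (ofLex z).1, (ofLex z).2),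
    fun z => toLex (p⁻¹ (ofLex z).1, (ofLex z).2), fun z => by simp, fun z => by simp⟩
  map_one' := by ext1 z; rfl
  map_mul' p q := by ext1 z; rfl

variable {G}

open Classical in
/-- the element `g` acting over the set `V` -/
noncomputable def vp : G →* Equiv.Perm (Lex (D × G)) where
  toFun g := ⟨fun z => toLex ((ofLex z).1, if (ofLex z).1 ∈ VV then g * (ofLex z).2 else (ofLex z).2),
    fun z => toLex ((ofLex z).1, if (ofLex z).1 ∈ VV then g⁻¹ * (ofLex z).2 else (ofLex z).2),
    fun z => by by_cases h : (ofLex z).1 ∈ VV <;> simp [h],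
    fun z => by by_cases h : (ofLex z).1 ∈ VV <;> simp [h]⟩
  map_one' := by
    ext1 z
    simp
  map_mul' a b := by
    ext1 z
    by_cases h : (ofLex z).1 ∈ VV <;> simp [h, mul_assoc]

theorem lft_apply (p : Equiv.Perm D) (x : D) (h : G) :
    lft G p (toLex (x, h)) = toLex (p x, h) := rfl

theorem vp_mem {x : D} (hx : x ∈ VV) (g h : G) : vp g (toLex (x, h)) = toLex (x, g * h) := by
  simp [vp, hx]

theorem vp_notMem {x : D} (hx : x ∉ VV) (g h : G) : vp g (toLex (x, h)) = toLex (x, h) := by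
  simp [vp, hx]

theorem vp_split (g : G) :
    vp g = (lft G f * vp g * (lft G f)⁻¹) * (lft G (σ⁻¹ * f) * vp g * (lft G (σ⁻¹ * f))⁻¹) := by
  ext1 z
  obtain ⟨x, h⟩ : ∃ x h, z = toLex (x, h) := ⟨(ofLex z).1, (ofLex z).2, rfl⟩
  rcases h with ⟨h, rfl⟩
  rw [← map_inv, ← map_inv]
  simp only [Equiv.Perm.mul_apply, lft_apply, mul_inv_rev, inv_inv]
  rcases VV_split x with ⟨h1, h2, h3⟩ | ⟨h1, h2, h3⟩ | ⟨h1, h2, h3⟩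
  · simp only [vp_mem h1, vp_notMem h3, vp_mem h2, lft_apply, Equiv.Perm.mul_apply,
      perm_apply_inv, perm_inv_apply]
  · simp only [vp_mem h1, vp_notMem h2, vp_mem h3, lft_apply, Equiv.Perm.mul_apply,
      perm_apply_inv, perm_inv_apply]
  · simp only [vp_notMem h1, vp_notMem h2, vp_notMem h3, lft_apply, Equiv.Perm.mul_apply,
      perm_apply_inv, perm_inv_apply]

def gens1 (X : Finset G) : Set (Equiv.Perm (Lex (D × G))) :=
  {lft G σ, lft G f} ∪ vp '' (X : Set G)

theorem gens1_finite (X : Finset G) : (gens1 X).Finite := by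
  unfold gens1
  exact (Set.toFinite _).union (X.finite_toSet.image _)

abbrev Gam (X : Finset G) := Subgroup.closure (gens1 X)

theorem lft_mem (X : Finset G) {p : Equiv.Perm D} (hp : p ∈ LL) : lft G p ∈ Gam X := by
  have : LL ≤ (Gam X).comap (lft G) := by
    unfold LL
    rw [Subgroup.closure_le]
    rintro p (rfl | rfl)
    · exact Subgroup.subset_closure (Or.inl (by simp))
    · exact Subgroup.subset_closure (Or.inl (by simp))
  exact this hp

theorem vp_mem_Gam {X : Finset G} (hX : Generates X) (g : G) : vp g ∈ Gam X := by
  have : (⊤ : Subgroup G) ≤ (Gam X).comap vp := by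
    rw [← hX, Subgroup.closure_le]
    intro x hx
    exact Subgroup.subset_closure (Or.inr ⟨x, hx, rfl⟩)
  exact this (Subgroup.mem_top g)

theorem mem_of_conj_mem {K : Type*} [Group K] (N : Subgroup K) [hN : N.Normal] {a b : K}
    (h : a * b * a⁻¹ ∈ N) : b ∈ N := by
  have := hN.conj_mem _ h a⁻¹
  simpa [mul_assoc] using this

theorem Gam_perfect (X : Finset G) : commutator (Gam X) = ⊤ := by
  set ls : LL →* Gam X := ((lft G).comp LL.subtype).codRestrict (Gam X) (fun p => lft_mem X p.2)
    with hls
  have hf : ls ⟨f, f_mem_LL⟩ ∈ commutator (Gam X) := by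
    apply mem_of_conj_mem (commutator (Gam X)) (a := ls ⟨mm, mm_mem_LL⟩)
    rw [← map_inv, ← map_mul, ← map_mul]
    have e : (⟨mm, mm_mem_LL⟩ * ⟨f, f_mem_LL⟩ * (⟨mm, mm_mem_LL⟩)⁻¹ : LL) =
      ⁅(⟨tr 2, tr_mem_LL 2⟩ * ⟨f, f_mem_LL⟩ * (⟨tr 2, tr_mem_LL 2⟩)⁻¹ : LL), ⟨f, f_mem_LL⟩⁆ := by
      apply Subtype.ext
      show mm * f * mm⁻¹ = (tr 2 * f * (tr 2)⁻¹) * f * (tr 2 * f * (tr 2)⁻¹)⁻¹ * f⁻¹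
      unfold f
      rw [mm_conj, tr2_conj, fstar, map_mul, map_mul, map_mul, map_inv, map_inv]
    rw [e, map_commutatorElement, commutator_def]
    exact Subgroup.commutator_mem_commutator (Subgroup.mem_top _) (Subgroup.mem_top _)
  have hσ : ls ⟨σ, σ_mem_LL⟩ ∈ commutator (Gam X) := by
    refine σ_mem_of_normal _ (g := ls ⟨f, f_mem_LL⟩) ?_ hf
    rw [← map_mul, ← map_pow, ← map_pow]
    congr 1
    apply Subtype.ext
    exact rel_σf
  rw [eq_top_iff, ← Subgroup.closure_closure_coe_preimage (k := gens1 X), Subgroup.closure_le]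
  rintro ⟨y, hy⟩ (hy' | ⟨g, hg, rfl⟩)
  · change y ∈ _ at hy'
    rcases hy' with rfl | rfl
    · exact hσ
    · exact hf
  · have hg : vp g ∈ Gam X := hy
    have e : (⟨vp g, hy⟩ : Gam X) = (ls ⟨f, f_mem_LL⟩)⁻¹ *
        ⁅(⟨vp g, hy⟩ : Gam X), ls ((⟨σ, σ_mem_LL⟩ : LL)⁻¹ * ⟨f, f_mem_LL⟩)⁆ * ls ⟨f, f_mem_LL⟩ := by
      apply Subtype.ext
      show vp g = (lft G f)⁻¹ * (vp g * lft G (σ⁻¹ * f) * (vp g)⁻¹ * (lft G (σ⁻¹ * f))⁻¹) * lft G f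
      have h := vp_split g
      have h2 : vp g * (lft G (σ⁻¹ * f) * (vp g)⁻¹ * (lft G (σ⁻¹ * f))⁻¹) =
        lft G f * vp g * (lft G f)⁻¹ := by
        nth_rewrite 1 [h]
        group
      have h3 : vp g * lft G (σ⁻¹ * f) * (vp g)⁻¹ * (lft G (σ⁻¹ * f))⁻¹ =
        lft G f * vp g * (lft G f)⁻¹ := by
        rw [← h2]; group
      rw [h3]
      group
    change (⟨vp g, hy⟩ : Gam X) ∈ commutator (Gam X)
    rw [e]
    have hc : ⁅(⟨vp g, hy⟩ : Gam X), ls ((⟨σ, σ_mem_LL⟩ : LL)⁻¹ * ⟨f, f_mem_LL⟩)⁆ ∈ commutator (Gam X) := by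
      rw [commutator_def]
      exact Subgroup.commutator_mem_commutator (Subgroup.mem_top _) (Subgroup.mem_top _)
    have := (inferInstance : (commutator (Gam X)).Normal).conj_mem _ hc (ls ⟨f, f_mem_LL⟩)⁻¹
    simpa using this

/-- fibrewise form of the elements of `Gam` -/
theorem Gam_form (X : Finset G) {w : Equiv.Perm (Lex (D × G))} (hw : w ∈ Gam X) :
    ∃ p : Equiv.Perm D, StrictMono p ∧ ∃ b : D → G, ∀ x h, w (toLex (x, h)) = toLex (p x, b x * h) := by
  induction hw using Subgroup.closure_induction with
  | mem w hw =>
    rcases hw with (rfl | rfl) | ⟨g, -, rfl⟩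
    · exact ⟨σ, tr_strictMono 1, fun _ => 1, fun x h => by simp [lft_apply]⟩
    · exact ⟨f, pc_strictMono _ _, fun _ => 1, fun x h => by simp [lft_apply]⟩
    · classical
      refine ⟨1, strictMono_id, fun x => if x ∈ VV then g else 1, fun x h => ?_⟩
      by_cases hx : x ∈ VV
      · simp [vp_mem hx, hx]
      · simp [vp_notMem hx, hx]
  | one => exact ⟨1, strictMono_id, fun _ => 1, fun x h => by simp⟩
  | mul a b _ _ ha hb =>
    obtain ⟨p, hp, u, hu⟩ := ha
    obtain ⟨q, hq, v, hv⟩ := hb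
    exact ⟨p * q, strictMono_mul hp hq, fun x => u (q x) * v x, fun x h => by
      simp [hv, hu, mul_assoc]⟩
  | inv a _ ha =>
    obtain ⟨p, hp, u, hu⟩ := ha
    refine ⟨p⁻¹, strictMono_inv hp, fun x => (u (p⁻¹ x))⁻¹, fun x h => ?_⟩
    rw [Equiv.Perm.inv_eq_iff_eq, hu]
    simp

theorem Gam_leftOrderable (hG : IsLeftOrderable G) (X : Finset G) : IsLeftOrderable (Gam X) := by
  obtain ⟨l, hl⟩ := hG
  let _ := l
  refine leftOrderable_of_action (Ω := Lex (D × G)) (Gam X).subtype Subtype.val_injective ?_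
  rintro ⟨w, hw⟩ z z' hzz
  obtain ⟨p, hp, b, hb⟩ := Gam_form X hw
  obtain ⟨x, h, rfl⟩ : ∃ x h, z = toLex (x, h) := ⟨(ofLex z).1, (ofLex z).2, rfl⟩
  obtain ⟨x', h', rfl⟩ : ∃ x h, z' = toLex (x, h) := ⟨(ofLex z').1, (ofLex z').2, rfl⟩
  show w _ < w _
  rw [hb, hb]
  rw [Prod.Lex.toLex_lt_toLex] at hzz ⊢
  rcases hzz with h1 | ⟨h1, h2⟩
  · exact Or.inl (hp h1)
  · simp only at h1 h2
    subst h1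
    refine Or.inr ⟨rfl, ?_⟩
    refine lt_of_le_of_ne (hl _ _ _ h2.le) ?_
    intro he
    exact h2.ne (mul_left_cancel he)

theorem zero_mem_VV : (0 : D) ∈ VV := by
  rw [VV_iff 0] <;> simp

theorem stage1 {X : Finset G} (hX : Generates X) (hG : IsLeftOrderable G) :
    ∃ (Γ : Type) (_ : Group Γ) (S : Finset Γ) (ψ : G →* Γ), Generates S ∧ IsLeftOrderable Γ ∧
      commutator Γ = ⊤ ∧ IsFrattini ψ ∧ ∀ g, wordLength S (ψ g) = wordLength X g := by
  obtain ⟨S, hS, hSm⟩ := finset_generates (gens1 X) (gens1_finite X)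
  refine ⟨Gam X, inferInstance, S, vp.codRestrict (Gam X) (fun g => vp_mem_Gam hX g), hS,
    Gam_leftOrderable hG X, Gam_perfect X, ?_⟩
  refine cocycle_embedding (Ω := Lex (D × G)) hX hS _ ?_ (Gam X).subtype
    (fun w z a => (ofLex (w.1 z)).2 = a * (ofLex z).2) ?_ ?_ ?_ ?_ ?_ (toLex (0, 1)) ?_ ?_ ?_
  · intro x hx
    rw [hSm]
    exact Or.inr ⟨x, hx, rfl⟩
  · intro w z a b ha hb
    rw [ha] at hb
    exact mul_right_cancel hb
  · intro w v z a b ha hb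
    show (ofLex (w.1 (v.1 z))).2 = _
    change (ofLex (w.1 (v.1 z))).2 = a * (ofLex (v.1 z)).2 at ha
    rw [ha, hb, mul_assoc]
  · intro z
    simp
  · intro w z a ha
    show (ofLex ((w.1)⁻¹ (w.1 z))).2 = a⁻¹ * (ofLex (w.1 z)).2
    rw [ha]
    simp
  · intro y hy z
    rw [hSm] at hy
    obtain ⟨x, h, rfl⟩ : ∃ x h, z = toLex (x, h) := ⟨(ofLex z).1, (ofLex z).2, rfl⟩
    rcases hy with (h1 | h1) | ⟨g, hg, h1⟩
    · exact ⟨1, by rw [h1]; simp [lft_apply], Or.inl rfl⟩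
    · exact ⟨1, by rw [h1]; simp [lft_apply], Or.inl rfl⟩
    · by_cases hx : x ∈ VV
      · exact ⟨g, by rw [← h1, vp_mem hx]; simp, Or.inr hg⟩
      · exact ⟨1, by rw [← h1, vp_notMem hx]; simp, Or.inl rfl⟩
  · intro g w a ha
    obtain ⟨p, hp, b, hb⟩ := Gam_form X w.2
    show (ofLex (w.1 (vp g (toLex (0, 1))))).2 = a * (ofLex (vp g (toLex (0, 1)))).2
    rw [vp_mem zero_mem_VV]
    rw [hb] at ha ⊢
    simp at ha ⊢
    exact ha
  · intro g
    show (ofLex (vp g (toLex (0, 1)))).2 = g * 1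
    rw [vp_mem zero_mem_VV]
    simp
  · intro g z
    obtain ⟨x, h, rfl⟩ : ∃ x h, z = toLex (x, h) := ⟨(ofLex z).1, (ofLex z).2, rfl⟩
    show (ofLex (vp g (toLex (x, h)))).2 = 1 * h ∨ (ofLex (vp g (toLex (x, h)))).2 = g * h
    by_cases hx : x ∈ VV
    · right; rw [vp_mem hx]; simp
    · left; rw [vp_notMem hx]; simp

end stage1

end IFE


namespace IFE

/-! ### Tiles -/

def inT (k : ℕ) (m : ℤ) (x : ℚ) : Prop := m - 1 / 7 < 2 ^ k * x ∧ 2 ^ k * x < m + 1 / 7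

theorem seven_not_dvd (i : ℕ) : ¬ (7 : ℤ) ∣ 2 ^ i := by
  intro h
  have := Int.Prime.dvd_pow' (p := 7) (by norm_num) h
  norm_num at this

theorem two_pow_mod_seven (i : ℕ) : (2 : ℤ) ^ i % 7 = 1 ∨ (2 : ℤ) ^ i % 7 = 2 ∨ (2 : ℤ) ^ i % 7 = 4 := by
  induction i with
  | zero => simp
  | succ n ih => rw [pow_succ]; omega

theorem seven_not_dvd_add (i j : ℕ) : ¬ (7 : ℤ) ∣ 2 ^ i + 2 ^ j := by
  have h1 := two_pow_mod_seven i
  have h2 := two_pow_mod_seven j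
  omega

theorem three_not_dvd (i : ℕ) : ¬ (3 : ℤ) ∣ 2 ^ i := by
  intro h
  have := Int.Prime.dvd_pow' (p := 3) (by norm_num) h
  norm_num at this

theorem inT_nest {j k : ℕ} (hjk : j ≤ k) {m n : ℤ} {x y : ℚ} (hx : inT k m x) (hy : inT k m y)
    (hj : inT j n y) : inT j n x := by
  obtain ⟨i, rfl⟩ := Nat.exists_eq_add_of_le hjk
  have hp : (0 : ℚ) < 2 ^ i := by positivity
  obtain ⟨x1, x2⟩ := hx
  obtain ⟨y1, y2⟩ := hy
  obtain ⟨z1, z2⟩ := hj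
  rw [pow_add, mul_comm (2 ^ j : ℚ), mul_assoc] at x1 x2 y1 y2
  have hd := seven_not_dvd i
  constructor
  · by_contra hc
    rw [not_lt] at hc
    have h1 := mul_le_mul_of_nonneg_left hc hp.le
    have h2 := mul_lt_mul_of_pos_left z1 hp
    have h3 : (-1 : ℚ) < 7 * (2 ^ i * n - m) - 2 ^ i := by linarith
    have h4 : 7 * (2 ^ i * n - m) - 2 ^ i < (1 : ℚ) := by linarith
    have h3' : (-1 : ℤ) < 7 * (2 ^ i * n - m) - 2 ^ i := by exact_mod_cast h3
    have h4' : 7 * (2 ^ i * n - m) - 2 ^ i < (1 : ℤ) := by exact_mod_cast h4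
    apply hd
    exact ⟨2 ^ i * n - m, by omega⟩
  · by_contra hc
    rw [not_lt] at hc
    have h1 := mul_le_mul_of_nonneg_left hc hp.le
    have h2 := mul_lt_mul_of_pos_left z2 hp
    have h3 : (-1 : ℚ) < 7 * (2 ^ i * n - m) + 2 ^ i := by linarith
    have h4 : 7 * (2 ^ i * n - m) + 2 ^ i < (1 : ℚ) := by linarith
    have h3' : (-1 : ℤ) < 7 * (2 ^ i * n - m) + 2 ^ i := by exact_mod_cast h3
    have h4' : 7 * (2 ^ i * n - m) + 2 ^ i < (1 : ℤ) := by exact_mod_cast h4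
    apply hd
    exact ⟨-(2 ^ i * n - m), by linarith⟩

theorem exists_inT (x : D) : ∃ k : ℕ, ∃ m : ℤ, inT k m x := by
  obtain ⟨k, m, h⟩ := x.2
  refine ⟨k, m, ?_, ?_⟩ <;> rw [mul_comm, h] <;> linarith

open Classical in
noncomputable def lev (x : D) : ℕ := Nat.find (exists_inT x)

open Classical in
theorem lev_spec (x : D) : ∃ m : ℤ, inT (lev x) m x := Nat.find_spec (exists_inT x)

open Classical in
theorem lev_le (x : D) {k : ℕ} {m : ℤ} (h : inT k m x) : lev x ≤ k :=
  Nat.find_min' (exists_inT x) ⟨m, h⟩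

noncomputable def num (x : D) : ℤ := (lev_spec x).choose

theorem num_spec (x : D) : inT (lev x) (num x) x := (lev_spec x).choose_spec

theorem inT_unique {k : ℕ} {m n : ℤ} {x : ℚ} (h : inT k m x) (h' : inT k n x) : m = n := by
  obtain ⟨h1, h2⟩ := h
  obtain ⟨h3, h4⟩ := h'
  have a1 : (m : ℚ) < n + 1 := by linarith
  have a2 : (n : ℚ) < m + 1 := by linarith
  have b1 : m < n + 1 := by exact_mod_cast a1
  have b2 : n < m + 1 := by exact_mod_cast a2
  omega

noncomputable def cen (x : D) : D := ⟨num x * (1 / 2 ^ lev x), dyadic.mul_mem (int_mem _) (two_pow_mem _)⟩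

theorem cen_coe (x : D) : 2 ^ lev x * (cen x : ℚ) = num x := by
  show 2 ^ lev x * ((num x : ℚ) * (1 / 2 ^ lev x)) = num x
  field_simp

/-- points of the tile of `x` -/
theorem tile_eq {x y : D} (h : inT (lev x) (num x) y) : lev y = lev x ∧ num y = num x := by
  have h1 : lev y = lev x := by
    apply le_antisymm (lev_le y h)
    apply lev_le x (m := num y)
    exact inT_nest (lev_le y h) (num_spec x) h (num_spec y)
  refine ⟨h1, ?_⟩
  have := num_spec y
  rw [h1] at this
  exact inT_unique this h

theorem cen_congr {x y : D} (h : lev y = lev x ∧ num y = num x) : cen y = cen x := by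
  apply Subtype.ext
  show (num y : ℚ) * (1 / 2 ^ lev y) = (num x : ℚ) * (1 / 2 ^ lev x)
  rw [h.1, h.2]

theorem inT_cen (x : D) : inT (lev x) (num x) (cen x) := by
  constructor <;> rw [cen_coe] <;> linarith

theorem lev_cen (x : D) : lev (cen x) = lev x := (tile_eq (inT_cen x)).1

theorem num_cen (x : D) : num (cen x) = num x := (tile_eq (inT_cen x)).2

theorem cen_cen (x : D) : cen (cen x) = cen x := cen_congr (tile_eq (inT_cen x))

theorem inT_convex {k : ℕ} {m : ℤ} {x y z : ℚ} (hx : inT k m x) (hz : inT k m z)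
    (h1 : x ≤ y) (h2 : y ≤ z) : inT k m y := by
  have hp : (0 : ℚ) < 2 ^ k := by positivity
  have a1 := mul_le_mul_of_nonneg_left h1 hp.le
  have a2 := mul_le_mul_of_nonneg_left h2 hp.le
  exact ⟨by linarith [hx.1], by linarith [hz.2]⟩

theorem inT_of_cen_eq {x y : D} (h : cen x = cen y) : inT (lev x) (num x) y := by
  have h1 : lev x = lev y := by rw [← lev_cen x, h, lev_cen]
  have h2 : num x = num y := by rw [← num_cen x, h, num_cen]
  rw [h1, h2]
  exact num_spec y

theorem cen_convex {x y z : D} (h1 : x ≤ y) (h2 : y ≤ z) (h : cen x = cen z) : cen y = cen x :=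
  cen_congr (tile_eq (inT_convex (num_spec x) (inT_of_cen_eq h) h1 h2))

theorem cen_mono {x y : D} (h : x ≤ y) : cen x ≤ cen y := by
  by_contra hc
  rw [not_le] at hc
  -- `cen y < cen x`, `x ≤ y`
  rcases le_total x (cen y) with h1 | h1
  · have := cen_convex h1 hc.le (cen_cen x).symm
    rw [cen_cen] at this
    exact hc.ne this
  · have := cen_convex h1 h (cen_cen y)
    rw [cen_cen] at this
    exact hc.ne' this

theorem lt_of_cen_lt {x y : D} (h : cen x < cen y) : x < y := by
  by_contra hc
  exact absurd (cen_mono (not_lt.1 hc)) (not_le.2 h)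

/-- `4/3` and `8/3` are not in any tile, and the separation is definite. -/
theorem third_sep (x : D) (a : ℕ) :
    (2 ^ a / 3 : ℚ) < x ↔ 2 ^ (lev x + a) + 1 ≤ 3 * num x := by
  have hp : (0 : ℚ) < 2 ^ lev x := by positivity
  obtain ⟨h1, h2⟩ := num_spec x
  have hd := three_not_dvd (lev x + a)
  constructor
  · intro h
    have := mul_lt_mul_of_pos_left h hp
    have h3 : (2 : ℚ) ^ (lev x + a) < 3 * num x + 1 := by
      rw [pow_add]; linarith
    have h4 : (2 : ℤ) ^ (lev x + a) < 3 * num x + 1 := by exact_mod_cast h3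
    have : (2 : ℤ) ^ (lev x + a) ≠ 3 * num x := fun he => hd ⟨_, he⟩
    omega
  · intro h
    have h3 : (2 : ℚ) ^ (lev x + a) + 1 ≤ 3 * num x := by exact_mod_cast h
    rw [pow_add] at h3
    have : (2 ^ lev x : ℚ) * (2 ^ a / 3) < 2 ^ lev x * x := by linarith
    exact lt_of_mul_lt_mul_left this hp.le

theorem third_sep' (x : D) (a : ℕ) :
    (x : ℚ) < 2 ^ a / 3 ↔ 3 * num x + 1 ≤ 2 ^ (lev x + a) := by
  have hp : (0 : ℚ) < 2 ^ lev x := by positivity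
  obtain ⟨h1, h2⟩ := num_spec x
  have hd := three_not_dvd (lev x + a)
  constructor
  · intro h
    have := mul_lt_mul_of_pos_left h hp
    have h3 : 3 * (num x : ℚ) - 1 < 2 ^ (lev x + a) := by
      rw [pow_add]; linarith
    have h4 : 3 * num x - 1 < (2 : ℤ) ^ (lev x + a) := by exact_mod_cast h3
    have : (2 : ℤ) ^ (lev x + a) ≠ 3 * num x := fun he => hd ⟨_, he⟩
    omega
  · intro h
    have h3 : 3 * (num x : ℚ) + 1 ≤ 2 ^ (lev x + a) := by exact_mod_cast h
    rw [pow_add] at h3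
    have : (2 ^ lev x : ℚ) * x < 2 ^ lev x * (2 ^ a / 3) := by linarith
    exact lt_of_mul_lt_mul_left this hp.le

def K0 : Set D := {x | 4 / 3 < (x : ℚ) ∧ (x : ℚ) < 8 / 3}

theorem mem_K0_iff (x : D) : x ∈ K0 ↔ 2 ^ (lev x + 2) + 1 ≤ 3 * num x ∧
    3 * num x + 1 ≤ 2 ^ (lev x + 3) := by
  rw [← third_sep, ← third_sep']
  norm_num [K0]

theorem cen_mem_K0 {x : D} : cen x ∈ K0 ↔ x ∈ K0 := by
  rw [mem_K0_iff, mem_K0_iff, lev_cen, num_cen]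

/-- Tile centres. -/
def TT : Set D := {t | t ∈ K0 ∧ cen t = t}

theorem cen_mem_TT {x : D} (h : x ∈ K0) : cen x ∈ TT := ⟨cen_mem_K0.2 h, cen_cen x⟩

theorem two_mem : ((2 : ℤ) : D) ∈ K0 := by
  have h : (((2 : ℤ) : D) : ℚ) = 2 := by push_cast; rfl
  exact ⟨by rw [h]; norm_num, by rw [h]; norm_num⟩

instance : Nonempty TT := ⟨⟨_, cen_mem_TT two_mem⟩⟩

theorem TT_lt (t : TT) {z : D} (hz : z ∈ K0) (h1 : (num t.1 + 1 / 7 : ℚ) / 2 ^ lev t.1 < z) :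
    t.1 < cen z := by
  have hp : (0 : ℚ) < 2 ^ lev t.1 := by positivity
  rw [div_lt_iff₀ hp] at h1
  have htz : t.1 ≤ z := by
    by_contra hc
    have hc' : (z : ℚ) < t.1 := not_le.1 hc
    have := mul_lt_mul_of_pos_left hc' hp
    have h2 := (num_spec t.1).2
    linarith
  have h3 := cen_mono htz
  rw [t.2.2] at h3
  refine lt_of_le_of_ne h3 ?_
  intro he
  have : cen t.1 = cen z := by rw [t.2.2]; exact he
  have := (inT_of_cen_eq this).2
  linarith

theorem TT_gt (t : TT) {z : D} (hz : z ∈ K0) (h1 : (z : ℚ) < (num t.1 - 1 / 7 : ℚ) / 2 ^ lev t.1) :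
    cen z < t.1 := by
  have hp : (0 : ℚ) < 2 ^ lev t.1 := by positivity
  rw [lt_div_iff₀ hp] at h1
  have htz : z ≤ t.1 := by
    by_contra hc
    have hc' : (t.1 : ℚ) < z := not_le.1 hc
    have := mul_lt_mul_of_pos_left hc' hp
    have h2 := (num_spec t.1).1
    linarith
  have h3 := cen_mono htz
  rw [t.2.2] at h3
  refine lt_of_le_of_ne h3 ?_
  intro he
  have : cen t.1 = cen z := by rw [t.2.2]; exact he.symm
  have := (inT_of_cen_eq this).1
  linarith

instance : NoMaxOrder TT := ⟨fun t => by
  have hp : (0 : ℚ) < 2 ^ lev t.1 := by positivity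
  have h := ((mem_K0_iff t.1).1 t.2.1).2
  have hq : 3 * (num t.1 : ℚ) + 1 ≤ 2 ^ (lev t.1 + 3) := by exact_mod_cast h
  rw [pow_add] at hq
  have h1 : (num t.1 + 1 / 7 : ℚ) / 2 ^ lev t.1 < 8 / 3 := by
    rw [div_lt_iff₀ hp]; linarith
  obtain ⟨z, hz1, hz2⟩ := dyadic_between h1
  have hK : z ∈ K0 := by
    refine ⟨?_, hz2⟩
    refine lt_trans ?_ hz1
    rw [lt_div_iff₀ hp]
    have h := ((mem_K0_iff t.1).1 t.2.1).1
    have hq : (2 : ℚ) ^ (lev t.1 + 2) + 1 ≤ 3 * (num t.1 : ℚ) := by exact_mod_cast h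
    rw [pow_add] at hq
    linarith
  exact ⟨⟨cen z, cen_mem_TT hK⟩, TT_lt t hK hz1⟩⟩

instance : NoMinOrder TT := ⟨fun t => by
  have hp : (0 : ℚ) < 2 ^ lev t.1 := by positivity
  have h := ((mem_K0_iff t.1).1 t.2.1).1
  have hq : (2 : ℚ) ^ (lev t.1 + 2) + 1 ≤ 3 * (num t.1 : ℚ) := by exact_mod_cast h
  rw [pow_add] at hq
  have h1 : 4 / 3 < (num t.1 - 1 / 7 : ℚ) / 2 ^ lev t.1 := by
    rw [lt_div_iff₀ hp]; linarith
  obtain ⟨z, hz1, hz2⟩ := dyadic_between h1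
  have hK : z ∈ K0 := by
    refine ⟨hz1, ?_⟩
    refine lt_trans hz2 ?_
    rw [div_lt_iff₀ hp]
    have h := ((mem_K0_iff t.1).1 t.2.1).2
    have hq : 3 * (num t.1 : ℚ) + 1 ≤ 2 ^ (lev t.1 + 3) := by exact_mod_cast h
    rw [pow_add] at hq
    linarith
  exact ⟨⟨cen z, cen_mem_TT hK⟩, TT_gt t hK hz2⟩⟩

theorem TT_sep {t t' : TT} (h : t < t') :
    (num t.1 + 1 / 7 : ℚ) / 2 ^ lev t.1 < (num t'.1 - 1 / 7 : ℚ) / 2 ^ lev t'.1 := by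
  have hp : (0 : ℚ) < 2 ^ lev t.1 := by positivity
  have hp' : (0 : ℚ) < 2 ^ lev t'.1 := by positivity
  have htt : (t.1 : ℚ) < t'.1 := h
  rcases lt_trichotomy ((num t.1 + 1 / 7 : ℚ) / 2 ^ lev t.1) ((num t'.1 - 1 / 7 : ℚ) / 2 ^ lev t'.1)
    with hc | hc | hc
  · exact hc
  · exfalso
    rw [div_eq_div_iff hp.ne' hp'.ne'] at hc
    have h1 : (7 * num t.1 + 1 : ℚ) * 2 ^ lev t'.1 = (7 * num t'.1 - 1) * 2 ^ lev t.1 := by linarith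
    have h2 : (7 * num t.1 + 1) * (2 : ℤ) ^ lev t'.1 = (7 * num t'.1 - 1) * 2 ^ lev t.1 := by
      exact_mod_cast h1
    apply seven_not_dvd_add (lev t.1) (lev t'.1)
    exact ⟨num t'.1 * 2 ^ lev t.1 - num t.1 * 2 ^ lev t'.1, by linarith⟩
  · exfalso
    have a1 : (t.1 : ℚ) < (num t.1 + 1 / 7 : ℚ) / 2 ^ lev t.1 := by
      rw [lt_div_iff₀ hp]; linarith [(num_spec t.1).2]
    have a2 : (num t'.1 - 1 / 7 : ℚ) / 2 ^ lev t'.1 < (t'.1 : ℚ) := by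
      rw [div_lt_iff₀ hp']; linarith [(num_spec t'.1).1]
    obtain ⟨z, hz1, hz2⟩ := dyadic_between (show max (t.1 : ℚ)
      ((num t'.1 - 1 / 7 : ℚ) / 2 ^ lev t'.1) < min (t'.1 : ℚ)
      ((num t.1 + 1 / 7 : ℚ) / 2 ^ lev t.1) from max_lt (lt_min htt a1) (lt_min a2 hc))
    obtain ⟨b1, b2⟩ := max_lt_iff.1 hz1
    obtain ⟨b3, b4⟩ := lt_min_iff.1 hz2
    have c1 := mul_lt_mul_of_pos_left b1 hp
    have c3 := mul_lt_mul_of_pos_left b3 hp'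
    rw [div_lt_iff₀ hp'] at b2
    rw [lt_div_iff₀ hp] at b4
    have d1 : inT (lev t.1) (num t.1) z := ⟨by linarith [(num_spec t.1).1], by linarith⟩
    have d2 : inT (lev t'.1) (num t'.1) z := ⟨by linarith, by linarith [(num_spec t'.1).2]⟩
    have e1 := cen_congr (tile_eq d1)
    have e2 := cen_congr (tile_eq d2)
    rw [t.2.2] at e1
    rw [t'.2.2] at e2
    rw [e1] at e2
    have : (t.1 : ℚ) = t'.1 := by rw [e2]
    linarith

instance : DenselyOrdered TT := ⟨fun t t' h => by
  obtain ⟨z, hz1, hz2⟩ := dyadic_between (TT_sep h)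
  have hp : (0 : ℚ) < 2 ^ lev t.1 := by positivity
  have hp' : (0 : ℚ) < 2 ^ lev t'.1 := by positivity
  have a1 : (t.1 : ℚ) < (num t.1 + 1 / 7 : ℚ) / 2 ^ lev t.1 := by
    rw [lt_div_iff₀ hp]; linarith [(num_spec t.1).2]
  have a2 : (num t'.1 - 1 / 7 : ℚ) / 2 ^ lev t'.1 < (t'.1 : ℚ) := by
    rw [div_lt_iff₀ hp']; linarith [(num_spec t'.1).1]
  have hK : z ∈ K0 := ⟨by linarith [t.2.1.1], by linarith [t'.2.1.2]⟩
  exact ⟨⟨cen z, cen_mem_TT hK⟩, TT_lt t hK hz1, TT_gt t' hK hz2⟩⟩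

end IFE


namespace IFE

theorem exists_TT_action (Γ : Type) [Group Γ] [Countable Γ] (hΓ : IsLeftOrderable Γ) :
    ∃ A : Γ → TT → TT, (∀ t, A 1 t = t) ∧ (∀ a b t, A (a * b) t = A a (A b t)) ∧
      (∀ a, StrictMono (A a)) ∧ ∀ a t, A a t = t → a = 1 := by
  obtain ⟨l, hl⟩ := hΓ
  letI := l
  have hl' : ∀ a b c : Γ, b < c → a * b < a * c := by
    intro a b c h
    refine lt_of_le_of_ne (hl a b c h.le) ?_
    intro he
    exact h.ne (mul_left_cancel he)
  haveI : Countable TT := by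
    have : Countable D := by
      show Countable {x : ℚ // x ∈ dyadic}
      infer_instance
    infer_instance
  haveI : Countable (Γ ×ₗ ℚ) := inferInstanceAs (Countable (Γ × ℚ))
  haveI : Nonempty (Γ ×ₗ ℚ) := ⟨toLex (1, 0)⟩
  haveI : NoMaxOrder (Γ ×ₗ ℚ) := ⟨fun p => by
    obtain ⟨q, hq⟩ := exists_gt (ofLex p).2
    exact ⟨toLex ((ofLex p).1, q), Prod.Lex.lt_iff.2 (Or.inr ⟨rfl, hq⟩)⟩⟩
  haveI : NoMinOrder (Γ ×ₗ ℚ) := ⟨fun p => by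
    obtain ⟨q, hq⟩ := exists_lt (ofLex p).2
    exact ⟨toLex ((ofLex p).1, q), Prod.Lex.lt_iff.2 (Or.inr ⟨rfl, hq⟩)⟩⟩
  haveI : DenselyOrdered (Γ ×ₗ ℚ) := ⟨fun p r h => by
    rcases Prod.Lex.lt_iff.1 h with h | ⟨h1, h2⟩
    · obtain ⟨q, hq⟩ := exists_gt (ofLex p).2
      exact ⟨toLex ((ofLex p).1, q), Prod.Lex.lt_iff.2 (Or.inr ⟨rfl, hq⟩),
        Prod.Lex.lt_iff.2 (Or.inl h)⟩
    · obtain ⟨q, hq1, hq2⟩ := exists_between h2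
      exact ⟨toLex ((ofLex p).1, q), Prod.Lex.lt_iff.2 (Or.inr ⟨rfl, hq1⟩),
        Prod.Lex.lt_iff.2 (Or.inr ⟨h1, hq2⟩)⟩⟩
  obtain ⟨e⟩ := Order.iso_of_countable_dense TT (Γ ×ₗ ℚ)
  refine ⟨fun a t => e.symm (toLex (a * (ofLex (e t)).1, (ofLex (e t)).2)), ?_, ?_, ?_, ?_⟩
  · intro t; simp
  · intro a b t; simp [mul_assoc]
  · intro a t t' h
    apply e.symm.strictMono
    have h := e.strictMono h
    rw [Prod.Lex.lt_iff] at h ⊢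
    rcases h with h | ⟨h1, h2⟩
    · exact Or.inl (hl' _ _ _ h)
    · exact Or.inr ⟨by simp [h1], h2⟩
  · intro a t h
    have h := congrArg e h
    simp only [OrderIso.apply_symm_apply] at h
    have h := congrArg (fun p => (ofLex p).1) h
    simpa using h

/-! ### affine maps between tiles -/

noncomputable def aff (t x : D) : D :=
  ⟨t + ((x : ℚ) - cen x) * 2 ^ lev x * (1 / 2 ^ lev t),
    dyadic.add_mem t.2 (dyadic.mul_mem (dyadic.mul_mem (dyadic.sub_mem x.2 (cen x).2)
      (dyadic.pow_mem (by simpa using int_mem 2) _)) (two_pow_mem _))⟩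

theorem aff_coe (t x : D) :
    (aff t x : ℚ) = t + ((x : ℚ) - cen x) * 2 ^ lev x * (1 / 2 ^ lev t) := rfl

theorem aff_mul (t x : D) : 2 ^ lev t * (aff t x : ℚ) =
    2 ^ lev t * t + (2 ^ lev x * (x : ℚ) - num x) := by
  rw [aff_coe, ← cen_coe x]
  field_simp

theorem aff_tile {t : D} (ht : cen t = t) (x : D) :
    lev (aff t x) = lev t ∧ num (aff t x) = num t := by
  apply tile_eq
  have h := cen_coe t
  rw [ht] at h
  obtain ⟨h1, h2⟩ := num_spec x
  constructor <;> rw [aff_mul, h] <;> linarith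

theorem cen_aff {t : D} (ht : cen t = t) (x : D) : cen (aff t x) = t := by
  rw [cen_congr (aff_tile ht x), ht]

theorem aff_cen (x : D) : aff (cen x) x = x := by
  apply Subtype.ext
  rw [aff_coe, lev_cen]
  field_simp
  ring

theorem aff_aff {t s : D} (ht : cen t = t) (x : D) : aff s (aff t x) = aff s x := by
  apply Subtype.ext
  have h : ((aff t x : ℚ) - t) * 2 ^ lev t = ((x : ℚ) - cen x) * 2 ^ lev x := by
    rw [aff_coe]; field_simp; ring
  rw [aff_coe s (aff t x), aff_coe s x, cen_aff ht, (aff_tile ht x).1, h]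

theorem aff_diff (t : D) {x y : D} (h : cen x = cen y) :
    (aff t y : ℚ) = aff t x + ((y : ℚ) - x) * 2 ^ lev x * (1 / 2 ^ lev t) := by
  have h1 : lev x = lev y := by rw [← lev_cen x, h, lev_cen]
  rw [aff_coe, aff_coe, h, h1]
  ring

noncomputable def up (n : ℕ) (x : D) : D := ⟨2 ^ n * (x : ℚ), dyadic.mul_mem
  (dyadic.pow_mem (by simpa using int_mem 2) _) x.2⟩

noncomputable def dn (n : ℕ) (x : D) : D := ⟨(1 / 2 ^ n) * (x : ℚ), dyadic.mul_mem
  (two_pow_mem _) x.2⟩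

theorem up_coe (n : ℕ) (x : D) : (up n x : ℚ) = 2 ^ n * x := rfl

theorem dn_coe (n : ℕ) (x : D) : (dn n x : ℚ) = (1 / 2 ^ n) * x := rfl

theorem up_dn (n : ℕ) (x : D) : up n (dn n x) = x := by
  apply Subtype.ext
  rw [up_coe, dn_coe]; field_simp

theorem dn_up (n : ℕ) (x : D) : dn n (up n x) = x := by
  apply Subtype.ext
  rw [dn_coe, up_coe]; field_simp

theorem up_unique {m n : ℕ} {x : D} (hm : up m x ∈ K0) (hn : up n x ∈ K0) : m = n := by
  have key : ∀ {m n : ℕ}, up m x ∈ K0 → up n x ∈ K0 → ¬ m < n := by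
    intro m n hm hn hlt
    have h1 := hm.1
    have h2 := hn.2
    rw [up_coe] at h1 h2
    have h3 : (2 : ℚ) ^ (m + 1) ≤ 2 ^ n := pow_le_pow_right₀ (by norm_num) hlt
    have hx : (0 : ℚ) < x := by
      by_contra hc
      have : (2 : ℚ) ^ m * x ≤ 0 := mul_nonpos_of_nonneg_of_nonpos (by positivity) (not_lt.1 hc)
      linarith
    have := mul_le_mul_of_nonneg_right h3 hx.le
    rw [pow_succ] at this
    linarith
  have := key hm hn
  have := key hn hm
  omega

theorem exists_up {x : D} (h0 : (0 : ℚ) < x) (h1 : (x : ℚ) < 8 / 3) : ∃ n, up n x ∈ K0 := by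
  classical
  have hex : ∃ n : ℕ, 4 / 3 < (2 : ℚ) ^ n * x := by
    obtain ⟨k, hk⟩ := exists_dyadic_lt (show (0 : ℚ) < x / 2 by linarith)
    refine ⟨k, ?_⟩
    have hp : (0 : ℚ) < 2 ^ k := by positivity
    rw [div_lt_iff₀ hp] at hk
    linarith
  refine ⟨Nat.find hex, Nat.find_spec hex, ?_⟩
  rw [up_coe]
  rcases Nat.eq_zero_or_pos (Nat.find hex) with h | h
  · rw [h]; simpa using h1
  · have h2 := Nat.find_min hex (Nat.sub_lt h one_pos)
    set n := Nat.find hex with hn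
    obtain ⟨m, hm⟩ : ∃ m, n = m + 1 := ⟨n - 1, by omega⟩
    rw [hm] at h2 ⊢
    simp only [Nat.add_sub_cancel, not_lt] at h2
    have h3 : (2 : ℚ) ^ m * x ≠ 4 / 3 := by
      intro he
      have a := third_sep (up m x) 2
      have b := third_sep' (up m x) 2
      rw [up_coe, he] at a b
      norm_num at a b
      have hd := three_not_dvd (lev (up m x) + 2)
      apply hd
      exact ⟨num (up m x), by omega⟩
    have h4 := lt_of_le_of_ne h2 h3
    rw [pow_succ]; linarith

theorem up_mem_iff {x : D} : (∃ n, up n x ∈ K0) ↔ (0 : ℚ) < x ∧ (x : ℚ) < 8 / 3 := by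
  refine ⟨?_, fun h => exists_up h.1 h.2⟩
  rintro ⟨n, h1, h2⟩
  rw [up_coe] at h1 h2
  have hx : (0 : ℚ) < x := by
    by_contra hc
    have : (2 : ℚ) ^ n * x ≤ 0 := mul_nonpos_of_nonneg_of_nonpos (by positivity) (not_lt.1 hc)
    linarith
  have : (1 : ℚ) ≤ 2 ^ n := one_le_pow₀ (by norm_num)
  refine ⟨hx, ?_⟩
  have := mul_le_mul_of_nonneg_right this hx.le
  linarith

section
variable {Γ : Type} (A : Γ → TT → TT)

open Classical in
noncomputable def R1 (γ : Γ) (x : D) : D :=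
  if h : x ∈ K0 then aff (A γ ⟨cen x, cen_mem_TT h⟩) x else x

theorem R1_of (γ : Γ) {x : D} (h : x ∈ K0) : R1 A γ x = aff (A γ ⟨cen x, cen_mem_TT h⟩) x :=
  dif_pos h

theorem cen_R1 (γ : Γ) {x : D} (h : x ∈ K0) : cen (R1 A γ x) = A γ ⟨cen x, cen_mem_TT h⟩ := by
  rw [R1_of A γ h, cen_aff (A γ _).2.2]

theorem R1_mem (γ : Γ) {x : D} (h : x ∈ K0) : R1 A γ x ∈ K0 := by
  rw [← cen_mem_K0, cen_R1 A γ h]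
  exact (A γ _).2.1

theorem R1_mono (hm : ∀ a, StrictMono (A a)) (γ : Γ) {x y : D} (hx : x ∈ K0) (hy : y ∈ K0)
    (h : x < y) : R1 A γ x < R1 A γ y := by
  rcases (cen_mono h.le).eq_or_lt with he | hl
  · rw [R1_of A γ hx, R1_of A γ hy]
    simp only [← he]
    have h1 := aff_diff (A γ ⟨cen x, cen_mem_TT hx⟩) he
    have h2 : (x : ℚ) < y := h
    have h3 : (0 : ℚ) < ((y : ℚ) - x) * 2 ^ lev x * (1 / 2 ^ lev
        (A γ ⟨cen x, cen_mem_TT hx⟩).1) := by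
      have : 0 < (y : ℚ) - x := by linarith
      positivity
    show (_ : ℚ) < _
    linarith
  · apply lt_of_cen_lt
    rw [cen_R1 A γ hx, cen_R1 A γ hy]
    exact hm γ (show (⟨cen x, cen_mem_TT hx⟩ : TT) < ⟨cen y, cen_mem_TT hy⟩ from hl)

open Classical in
noncomputable def RR (γ : Γ) (x : D) : D :=
  if h : ∃ n, up n x ∈ K0 then dn h.choose (R1 A γ (up h.choose x)) else x

theorem RR_of (γ : Γ) {n : ℕ} {x : D} (h : up n x ∈ K0) : RR A γ x = dn n (R1 A γ (up n x)) := by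
  have h' : ∃ n, up n x ∈ K0 := ⟨n, h⟩
  have : h'.choose = n := up_unique h'.choose_spec h
  rw [RR, dif_pos h', this]

theorem up_RR (γ : Γ) {n : ℕ} {x : D} (h : up n x ∈ K0) : up n (RR A γ x) = R1 A γ (up n x) := by
  rw [RR_of A γ h, up_dn]

theorem RR_out (γ : Γ) {x : D} (h : ¬ ((0 : ℚ) < x ∧ (x : ℚ) < 8 / 3)) : RR A γ x = x :=
  dif_neg (fun hc => h (up_mem_iff.1 hc))

theorem RR_in (γ : Γ) {x : D} (h : ((0 : ℚ) < x ∧ (x : ℚ) < 8 / 3)) :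
    (0 : ℚ) < RR A γ x ∧ (RR A γ x : ℚ) < 8 / 3 := by
  obtain ⟨n, hn⟩ := exists_up h.1 h.2
  apply up_mem_iff.1
  exact ⟨n, by rw [up_RR A γ hn]; exact R1_mem A γ hn⟩

theorem RR_mono (hm : ∀ a, StrictMono (A a)) (γ : Γ) : StrictMono (RR A γ) := by
  intro x y hxy
  have hxy' : (x : ℚ) < y := hxy
  by_cases hx : (0 : ℚ) < x ∧ (x : ℚ) < 8 / 3
  · by_cases hy : (0 : ℚ) < y ∧ (y : ℚ) < 8 / 3
    · obtain ⟨n, hn⟩ := exists_up hx.1 hx.2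
      obtain ⟨m, hm'⟩ := exists_up hy.1 hy.2
      have hmn : m ≤ n := by
        by_contra hc
        rw [not_le] at hc
        have h1 := hn.1
        have h2 := hm'.2
        rw [up_coe] at h1 h2
        have h3 : (2 : ℚ) ^ (n + 1) ≤ 2 ^ m := pow_le_pow_right₀ (by norm_num) hc
        have h4 := mul_le_mul_of_nonneg_right h3 hy.1.le
        rw [pow_succ] at h4
        have h5 := mul_lt_mul_of_pos_left hxy' (show (0 : ℚ) < 2 ^ n by positivity)
        linarith
      have hu := R1_mem A γ hn
      have hv := R1_mem A γ hm'
      rw [← up_RR A γ hn] at hu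
      rw [← up_RR A γ hm'] at hv
      rcases hmn.eq_or_lt with he | hl
      · subst he
        have h1 : up m x < up m y := by
          show (2 : ℚ) ^ m * x < 2 ^ m * y
          exact mul_lt_mul_of_pos_left hxy' (by positivity)
        have h2 := R1_mono A hm γ hn hm' h1
        rw [← up_RR A γ hn, ← up_RR A γ hm'] at h2
        have h3 : (2 : ℚ) ^ m * (RR A γ x) < 2 ^ m * (RR A γ y) := h2
        show (RR A γ x : ℚ) < RR A γ y
        exact lt_of_mul_lt_mul_left h3 (by positivity)
      · by_contra hc
        have hc' : (RR A γ y : ℚ) ≤ RR A γ x := not_lt.1 hc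
        have h1 := hu.2
        have h2 := hv.1
        rw [up_coe] at h1 h2
        have h3 : (2 : ℚ) ^ (m + 1) ≤ 2 ^ n := pow_le_pow_right₀ (by norm_num) hl
        have h4 := mul_le_mul_of_nonneg_right h3 (RR_in A γ hx).1.le
        rw [pow_succ] at h4
        have h5 := mul_le_mul_of_nonneg_left hc' (show (0 : ℚ) ≤ 2 ^ m by positivity)
        linarith
    · rw [RR_out A γ hy]
      have := RR_in A γ hx
      have h8 : ¬ (y : ℚ) < 8 / 3 := fun h => hy ⟨by linarith, h⟩
      show (_ : ℚ) < _
      linarith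
  · rw [RR_out A γ hx]
    by_cases hy : (0 : ℚ) < y ∧ (y : ℚ) < 8 / 3
    · have := RR_in A γ hy
      have h8 : ¬ (0 : ℚ) < x := fun h => hx ⟨h, by linarith⟩
      show (_ : ℚ) < _
      linarith
    · rw [RR_out A γ hy]
      exact hxy

theorem R1_one [Group Γ] (h1 : ∀ t, A 1 t = t) {x : D} (hx : x ∈ K0) : R1 A 1 x = x := by
  rw [R1_of A 1 hx, h1, aff_cen]

theorem R1_mul [Group Γ] (h2 : ∀ a b t, A (a * b) t = A a (A b t)) (a b : Γ) {x : D}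
    (hx : x ∈ K0) : R1 A (a * b) x = R1 A a (R1 A b x) := by
  have hb := R1_mem A b hx
  have : (⟨cen (R1 A b x), cen_mem_TT hb⟩ : TT) = A b ⟨cen x, cen_mem_TT hx⟩ :=
    Subtype.ext (cen_R1 A b hx)
  rw [R1_of A _ hx, R1_of A a hb, this, h2, R1_of A b hx, aff_aff (A b _).2.2]

theorem RR_one [Group Γ] (h1 : ∀ t, A 1 t = t) (x : D) : RR A 1 x = x := by
  by_cases hx : (0 : ℚ) < x ∧ (x : ℚ) < 8 / 3
  · obtain ⟨n, hn⟩ := exists_up hx.1 hx.2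
    rw [RR_of A _ hn, R1_one A h1 hn, dn_up]
  · exact RR_out A _ hx

theorem RR_mul [Group Γ] (h2 : ∀ a b t, A (a * b) t = A a (A b t)) (a b : Γ) (x : D) :
    RR A (a * b) x = RR A a (RR A b x) := by
  by_cases hx : (0 : ℚ) < x ∧ (x : ℚ) < 8 / 3
  · obtain ⟨n, hn⟩ := exists_up hx.1 hx.2
    have hb := R1_mem A b hn
    rw [← up_RR A b hn] at hb
    rw [RR_of A _ hn, R1_mul A h2 a b hn, RR_of A a hb, up_RR A b hn]
  · rw [RR_out A _ hx, RR_out A b hx, RR_out A a hx]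

theorem RR_half (γ : Γ) {x y : D} (hx : (0 : ℚ) < x ∧ (x : ℚ) < 8 / 3) (hy : (y : ℚ) = x / 2) :
    (RR A γ y : ℚ) = (RR A γ x) / 2 := by
  obtain ⟨n, hn⟩ := exists_up hx.1 hx.2
  have he : up (n + 1) y = up n x := by
    apply Subtype.ext
    rw [up_coe, up_coe, hy, pow_succ]; ring
  have hn' : up (n + 1) y ∈ K0 := by rwa [he]
  rw [RR_of A γ hn, RR_of A γ hn', he, dn_coe, dn_coe, pow_succ]
  field_simp

theorem RR_affine (γ : Γ) {x : D} (hx : (0 : ℚ) < x ∧ (x : ℚ) < 8 / 3) :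
    ∃ k : ℤ, ∃ δ : ℚ, 0 < δ ∧ ∀ y : D, (x : ℚ) ≤ y → (y : ℚ) < x + δ →
      (RR A γ y : ℚ) = RR A γ x + 2 ^ k * ((y : ℚ) - x) := by
  obtain ⟨n, hn⟩ := exists_up hx.1 hx.2
  set z := up n x with hz
  have hp : (0 : ℚ) < 2 ^ lev z := by positivity
  have hpn : (0 : ℚ) < 2 ^ n := by positivity
  obtain ⟨h1, h2⟩ := num_spec z
  set t := A γ ⟨cen z, cen_mem_TT hn⟩ with ht
  refine ⟨(lev z : ℤ) - lev t.1, ((num z + 1 / 7) - 2 ^ lev z * z) / 2 ^ lev z / 2 ^ n, ?_, ?_⟩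
  · have : 0 < (num z + 1 / 7 : ℚ) - 2 ^ lev z * z := by linarith
    positivity
  · intro y hy1 hy2
    have hu1 : (z : ℚ) ≤ up n y := mul_le_mul_of_nonneg_left hy1 hpn.le
    have hu2 : 2 ^ lev z * (up n y : ℚ) < num z + 1 / 7 := by
      rw [← sub_lt_iff_lt_add', lt_div_iff₀ hpn, lt_div_iff₀ hp] at hy2
      have : (up n y : ℚ) = z + ((y : ℚ) - x) * 2 ^ n := by
        rw [hz, up_coe, up_coe]; ring
      rw [this]; linarith
    have hc : lev (up n y) = lev z ∧ num (up n y) = num z := by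
      apply tile_eq
      exact ⟨by linarith [mul_le_mul_of_nonneg_left hu1 hp.le], hu2⟩
    have hce := cen_congr hc
    have hyK : up n y ∈ K0 := by
      rw [← cen_mem_K0, hce, cen_mem_K0]; exact hn
    rw [RR_of A γ hn, RR_of A γ hyK, R1_of A γ hn, R1_of A γ hyK]
    simp only [hce, ← hz]
    rw [← ht, dn_coe, dn_coe, aff_diff t.1 hce.symm, zpow_sub₀ (by norm_num), zpow_natCast,
      zpow_natCast]
    have : (up n y : ℚ) = z + ((y : ℚ) - x) * 2 ^ n := by
      rw [hz, up_coe, up_coe]; ring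
    rw [this]
    field_simp
    ring

theorem RR_faithful [Group Γ] (hf : ∀ a t, A a t = t → a = 1) (γ : Γ)
    (h : ∃ δ : ℚ, 0 < δ ∧ ∃ k : ℤ, ∀ x : D, (0 : ℚ) < x → (x : ℚ) < δ →
      (RR A γ x : ℚ) = 2 ^ k * x) : γ = 1 := by
  obtain ⟨δ, hδ, k, hk⟩ := h
  obtain ⟨t⟩ := (inferInstance : Nonempty TT)
  have ht := t.2.1
  have ht1 := ht.1
  have ht2 := ht.2
  obtain ⟨n, hn⟩ := exists_dyadic_lt (show (0 : ℚ) < δ / 3 by linarith)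
  have hpn : (0 : ℚ) < 1 / 2 ^ n := by positivity
  have hx : up n (dn n t.1) ∈ K0 := by rwa [up_dn]
  have h1 := hk (dn n t.1) (by rw [dn_coe]; have : (0 : ℚ) < t.1 := by linarith
                               positivity)
    (by rw [dn_coe]
        have := mul_lt_mul_of_pos_left ht2 hpn
        linarith)
  rw [RR_of A γ hx, up_dn, R1_of A γ ht, dn_coe, dn_coe] at h1
  have e1 : (⟨cen t.1, cen_mem_TT ht⟩ : TT) = t := Subtype.ext t.2.2
  have e2 : (aff (A γ t).1 t.1 : ℚ) = (A γ t).1 := by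
    rw [aff_coe, t.2.2]; ring
  rw [e1, e2] at h1
  have h2 : ((A γ t).1 : ℚ) = 2 ^ k * t.1 := by
    have : (1 / 2 ^ n : ℚ) * (A γ t).1 = 1 / 2 ^ n * (2 ^ k * t.1) := by rw [h1]; ring
    exact mul_left_cancel₀ hpn.ne' this
  have ha1 := (A γ t).2.1.1
  have ha2 := (A γ t).2.1.2
  have hk0 : k = 0 := by
    rcases lt_trichotomy k 0 with h | h | h
    · exfalso
      have : (2 : ℚ) ^ k ≤ 2 ^ (-1 : ℤ) := zpow_le_zpow_right₀ (by norm_num) (by omega)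
      have := mul_le_mul_of_nonneg_right this (show (0 : ℚ) ≤ t.1 by linarith)
      norm_num at this
      linarith
    · exact h
    · exfalso
      have : (2 : ℚ) ^ (1 : ℤ) ≤ 2 ^ k := zpow_le_zpow_right₀ (by norm_num) (by omega)
      have := mul_le_mul_of_nonneg_right this (show (0 : ℚ) ≤ t.1 by linarith)
      norm_num at this
      linarith
  rw [hk0, zpow_zero, one_mul] at h2
  exact hf γ t (Subtype.ext (Subtype.ext h2))

end

theorem tiles (Γ : Type) [Group Γ] [Countable Γ] (hΓ : IsLeftOrderable Γ) :
    ∃ ρ : Γ →* Equiv.Perm D,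
      (∀ γ (x : D), ¬ ((0 : ℚ) < x ∧ (x : ℚ) < 8 / 3) → ρ γ x = x) ∧
      (∀ γ, StrictMono (ρ γ)) ∧
      (∀ γ (x y : D), (0 : ℚ) < x ∧ (x : ℚ) < 8 / 3 → (y : ℚ) = x / 2 →
        (ρ γ y : ℚ) = (ρ γ x) / 2) ∧
      (∀ γ (x : D), (0 : ℚ) < x ∧ (x : ℚ) < 8 / 3 →
        ∃ k : ℤ, ∃ δ : ℚ, 0 < δ ∧ ∀ y : D, (x : ℚ) ≤ y → (y : ℚ) < x + δ →
          (ρ γ y : ℚ) = ρ γ x + 2 ^ k * ((y : ℚ) - x)) ∧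
      (∀ γ, (∃ δ : ℚ, 0 < δ ∧ ∃ k : ℤ, ∀ x : D, (0 : ℚ) < x → (x : ℚ) < δ →
        (ρ γ x : ℚ) = 2 ^ k * x) → γ = 1) := by
  obtain ⟨A, h1, h2, hm, hf⟩ := exists_TT_action Γ hΓ
  let ρ : Γ →* Equiv.Perm D :=
    { toFun := fun γ => ⟨RR A γ, RR A γ⁻¹, fun x => by rw [← RR_mul A h2, inv_mul_cancel, RR_one A h1],
        fun x => by rw [← RR_mul A h2, mul_inv_cancel, RR_one A h1]⟩
      map_one' := Equiv.ext fun x => RR_one A h1 x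
      map_mul' := fun a b => Equiv.ext fun x => RR_mul A h2 a b x }
  exact ⟨ρ, fun γ x h => RR_out A γ h, fun γ => RR_mono A hm γ, fun γ x y => RR_half A γ,
    fun γ x => RR_affine A γ, fun γ => RR_faithful A hf γ⟩

end IFE


namespace IFE

open scoped commutatorElement

/-! ### The Toeplitz set -/

def C1 : Set ℤ := {k | Odd (padicValInt 2 (3 * k + 1))}

theorem val_two (v : ℕ) {w : ℤ} (hw : Odd w) : padicValInt 2 (2 ^ v * w) = v := by
  have hw0 : w ≠ 0 := by rintro rfl; simp at hw
  have h2 : ¬ (2 : ℤ) ∣ w := by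
    rw [← even_iff_two_dvd, Int.not_even_iff_odd]; exact hw
  rw [padicValInt.mul (by positivity) hw0]
  have e1 : padicValInt 2 w = 0 := by
    apply padicValInt.eq_zero_of_not_dvd
    exact_mod_cast h2
  have e2 : padicValInt 2 ((2 : ℤ) ^ v) = v := by
    have : ((2 : ℤ) ^ v) = ((2 ^ v : ℕ) : ℤ) := by push_cast; rfl
    rw [this, padicValInt.of_nat, padicValNat.prime_pow]
  rw [e1, e2, add_zero]

theorem exists_two_odd {n : ℤ} (hn : n ≠ 0) : ∃ v : ℕ, ∃ w : ℤ, Odd w ∧ n = 2 ^ v * w := by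
  obtain ⟨v, m, hm, h⟩ := Nat.exists_eq_two_pow_mul_odd (n := n.natAbs) (by simpa using hn)
  have hm' : Odd (m : ℤ) := by exact_mod_cast hm
  rcases Int.natAbs_eq n with h' | h'
  · exact ⟨v, m, hm', by rw [h', h]; push_cast; ring⟩
  · exact ⟨v, -m, hm'.neg, by rw [h', h]; push_cast; ring⟩

def Toep (C : Set ℤ) : Prop := ∀ k, ∃ M : ℤ, 0 < M ∧ ∀ j, (k + M * j ∈ C ↔ k ∈ C)

theorem Toep_C1 : Toep C1 := by
  intro k
  obtain ⟨v, w, hw, h⟩ := exists_two_odd (n := 3 * k + 1) (by omega)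
  refine ⟨2 ^ (v + 1), by positivity, fun j => ?_⟩
  have h' : 3 * (k + 2 ^ (v + 1) * j) + 1 = 2 ^ v * (w + 2 * (3 * j)) := by
    have : 3 * (k + 2 ^ (v + 1) * j) + 1 = (3 * k + 1) + 3 * (2 ^ (v + 1) * j) := by ring
    rw [this, h, pow_succ]; ring
  have hw' : Odd (w + 2 * (3 * j)) := hw.add_even (even_two_mul _)
  show Odd (padicValInt 2 _) ↔ Odd (padicValInt 2 _)
  rw [h', h, val_two v hw, val_two v hw']

theorem C1_sep {k : ℤ} (hk : k ≠ 0) : ∃ i, ¬ (i ∈ C1 ↔ i + k ∈ C1) := by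
  obtain ⟨a, u, hu, h⟩ := exists_two_odd hk
  have h3 : ∃ i : ℤ, 3 * i + 1 = 2 ^ a * (9 * (2 + u) + 4 * 2 ^ a) := by
    have h4 : (3 : ℤ) ∣ 4 ^ a - 1 := by
      have := sub_dvd_pow_sub_pow (4 : ℤ) 1 a
      simpa using this
    obtain ⟨c, hc⟩ := h4
    refine ⟨2 ^ a * (3 * (2 + u)) + (4 * c + 1), ?_⟩
    have e : (2 : ℤ) ^ a * 2 ^ a = 4 ^ a := by rw [← mul_pow]; norm_num
    have e' : (2 : ℤ) ^ a * 2 ^ a = 3 * c + 1 := by rw [e]; linarith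
    linear_combination -4 * e'
  obtain ⟨i, hi⟩ := h3
  refine ⟨i, ?_⟩
  obtain ⟨b, rfl⟩ := hu
  have w1 : Odd (9 * (2 + (2 * b + 1)) + 4 * 2 ^ a : ℤ) := by
    refine ⟨13 + 9 * b + 2 * 2 ^ a, by ring⟩
  have e1 : 3 * (i + k) + 1 = 2 ^ (a + 1) * (15 + 12 * b + 2 * 2 ^ a) := by
    rw [mul_add, add_right_comm, hi, h]; ring
  have w2 : Odd (15 + 12 * b + 2 * 2 ^ a : ℤ) := ⟨7 + 6 * b + 2 ^ a, by ring⟩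
  show ¬ (Odd (padicValInt 2 (3 * i + 1)) ↔ Odd (padicValInt 2 (3 * (i + k) + 1)))
  rw [hi, e1, val_two _ w1, val_two _ w2, Nat.odd_add_one]
  tauto

theorem Toep.shift {C : Set ℤ} (h : Toep C) (j : ℤ) : Toep {k | k - j ∈ C} := by
  intro k
  obtain ⟨M, hM, hk⟩ := h (k - j)
  refine ⟨M, hM, fun i => ?_⟩
  have := hk i
  rw [show k - j + M * i = k + M * i - j by ring] at this
  exact this

theorem Toep.compl {C : Set ℤ} (h : Toep C) : Toep Cᶜ := by
  intro k
  obtain ⟨M, hM, hk⟩ := h k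
  exact ⟨M, hM, fun j => not_congr (hk j)⟩

theorem Toep.inter {C E : Set ℤ} (h : Toep C) (h' : Toep E) : Toep (C ∩ E) := by
  intro k
  obtain ⟨M, hM, hk⟩ := h k
  obtain ⟨M', hM', hk'⟩ := h' k
  refine ⟨M * M', by positivity, fun j => ?_⟩
  have a := hk (M' * j)
  have b := hk' (M * j)
  rw [← mul_assoc] at a
  rw [← mul_assoc, mul_comm M'] at b
  exact and_congr a b

theorem Toep_univ : Toep Set.univ := fun _ => ⟨1, one_pos, fun _ => by simp⟩

/-! ### Identities for `pc` -/

theorem pc_comm (C E : Set ℤ) (p q : Q) : ⁅pc C p, pc E q⁆ = pc (C ∩ E) ⁅p, q⁆ := by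
  classical
  show ⁅bl _, bl _⁆ = bl _
  rw [← map_commutatorElement]
  congr 1
  funext k
  by_cases h1 : k ∈ C <;> by_cases h2 : k ∈ E <;>
    simp [h1, h2, commutatorElement_def]

theorem pc_union (C E : Set ℤ) (p : Q) : pc C p * pc (E ∩ Cᶜ) p = pc (C ∪ E) p := by
  classical
  show bl _ * bl _ = bl _
  rw [← map_mul]
  congr 1
  funext k
  by_cases h1 : k ∈ C <;> by_cases h2 : k ∈ E <;> simp [h1, h2]

theorem pc_compl (C : Set ℤ) (p : Q) : pc Set.univ p * (pc C p)⁻¹ = pc Cᶜ p := by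
  classical
  show bl _ * (bl _)⁻¹ = bl _
  rw [← map_inv, ← map_mul]
  congr 1
  funext k
  by_cases h1 : k ∈ C <;> simp [h1]

theorem pc_empty (p : Q) : pc ∅ p = 1 := by
  ext1 x
  exact pc_notMem p (by simp)

theorem right_cont {h : Equiv.Perm D} (hm : StrictMono h) (x : D) {η : ℚ} (hη : 0 < η) :
    ∃ δ : ℚ, 0 < δ ∧ ∀ y : D, (x : ℚ) ≤ y → (y : ℚ) < x + δ →
      ((h x : D) : ℚ) ≤ (h y : D) ∧ ((h y : D) : ℚ) < (h x : D) + η := by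
  obtain ⟨z, hz1, hz2⟩ := dyadic_between (show ((h x : D) : ℚ) < (h x : D) + η by linarith)
  have h1 : h x < z := hz1
  have h2 : x < h⁻¹ z := by
    have := strictMono_inv hm h1
    simpa using this
  have h2' : (x : ℚ) < (h⁻¹ z : D) := h2
  refine ⟨((h⁻¹ z : D) : ℚ) - x, by linarith, fun y hy1 hy2 => ?_⟩
  have a1 : h x ≤ h y := hm.monotone (show x ≤ y from hy1)
  have a2 : y < h⁻¹ z := show (y : ℚ) < (h⁻¹ z : D) by linarith
  have a3 : h y < z := by
    have := hm a2
    simpa using this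
  have a3' : ((h y : D) : ℚ) < z := a3
  exact ⟨a1, by linarith⟩

structure Setup (P : Subgroup Q) (H : Subgroup (Equiv.Perm D)) : Prop where
  f0m : f0 ∈ P
  key : ∀ (M : Subgroup (Equiv.Perm D)) (E : Set ℤ), (∀ m ∈ M, mm⁻¹ * m * mm ∈ M) →
    (∀ m ∈ M, tr 2 * m * (tr 2)⁻¹ ∈ M) → (∀ p ∈ P, ∀ q ∈ P, pc E ⁅p, q⁆ ∈ M) →
    ∀ p ∈ P, pc E p ∈ M
  supp : ∀ p ∈ P, ∀ x : D, ¬ (-1 ≤ (x : ℚ) ∧ (x : ℚ) < 4) → p.1 x = x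
  σm : σ ∈ H
  um : ∀ p ∈ P, pc Set.univ p ∈ H
  cm : ∀ p ∈ P, pc C1 p ∈ H
  gen : ∀ K : Subgroup (Equiv.Perm D), σ ∈ K → (∀ p ∈ P, pc Set.univ p ∈ K) →
    (∀ p ∈ P, pc C1 p ∈ K) → H ≤ K

def BB (P : Subgroup Q) (H : Subgroup (Equiv.Perm D)) (C : Set ℤ) : Prop :=
  Toep C ∧ ∀ p ∈ P, pc C p ∈ H

section
variable {P : Subgroup Q} {H : Subgroup (Equiv.Perm D)}

theorem Setup.tr_mem (s : Setup P H) (k : ℤ) : tr k ∈ H := by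
  rw [← σ_zpow]; exact H.zpow_mem s.σm k

theorem Setup.LL_le (s : Setup P H) : LL ≤ H := by
  unfold LL
  rw [Subgroup.closure_le]
  rintro x (rfl | rfl)
  · exact s.σm
  · exact s.um _ s.f0m

theorem Setup.mm_mem (s : Setup P H) : mm ∈ H := s.LL_le mm_mem_LL

theorem BB.univ (s : Setup P H) : BB P H Set.univ := ⟨Toep_univ, s.um⟩

theorem BB.C1 (s : Setup P H) : BB P H C1 := ⟨Toep_C1, s.cm⟩

theorem BB.compl (s : Setup P H) {C : Set ℤ} (h : BB P H C) : BB P H Cᶜ :=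
  ⟨h.1.compl, fun p hp => by
    rw [← pc_compl]; exact H.mul_mem (s.um p hp) (H.inv_mem (h.2 p hp))⟩

theorem BB.shift (s : Setup P H) {C : Set ℤ} (h : BB P H C) (j : ℤ) :
    BB P H {k | k - j ∈ C} :=
  ⟨h.1.shift j, fun p hp => by
    rw [← tr_conj_pc]
    exact H.mul_mem (H.mul_mem (s.tr_mem _) (h.2 p hp)) (H.inv_mem (s.tr_mem _))⟩

theorem BB.inter (s : Setup P H) {C E : Set ℤ} (h : BB P H C) (h' : BB P H E) :
    BB P H (C ∩ E) :=
  ⟨h.1.inter h'.1, s.key H _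
    (fun m hm => H.mul_mem (H.mul_mem (H.inv_mem s.mm_mem) hm) s.mm_mem)
    (fun m hm => H.mul_mem (H.mul_mem (s.tr_mem 2) hm) (H.inv_mem (s.tr_mem 2)))
    (fun p hp q hq => by
      rw [← pc_comm]
      have a := h.2 p hp
      have b := h'.2 q hq
      exact H.mul_mem (H.mul_mem (H.mul_mem a b) (H.inv_mem a)) (H.inv_mem b))⟩

def Loc (P : Subgroup Q) (H : Subgroup (Equiv.Perm D)) (h : Equiv.Perm D) : Prop :=
  ∀ x : D, ∃ C, BB P H C ∧ 0 ∈ C ∧ ∃ δ : ℚ, 0 < δ ∧ ∀ k ∈ C, ∀ y : D, (x : ℚ) ≤ y →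
    (y : ℚ) < x + δ → h (tr (6 * k) y) = tr (6 * k) (h y)

def LocG (s : Setup P H) : Subgroup (Equiv.Perm D) where
  carrier := {h | StrictMono h ∧ Loc P H h}
  one_mem' := ⟨strictMono_id, fun x => ⟨_, BB.univ s, trivial, 1, one_pos, fun _ _ _ _ _ => rfl⟩⟩
  mul_mem' := by
    rintro h g ⟨hm, hl⟩ ⟨gm, gl⟩
    refine ⟨strictMono_mul hm gm, fun x => ?_⟩
    obtain ⟨C, hC, h0, δ, hδ, hk⟩ := gl x
    obtain ⟨C', hC', h0', δ', hδ', hk'⟩ := hl (g x)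
    obtain ⟨ε, hε, hc⟩ := right_cont gm x hδ'
    refine ⟨C ∩ C', BB.inter s hC hC', ⟨h0, h0'⟩, min δ ε, lt_min hδ hε, ?_⟩
    intro k hkC y hy1 hy2
    have a1 := min_le_left δ ε
    have a2 := min_le_right δ ε
    have b := hc y hy1 (by linarith)
    simp only [Equiv.Perm.mul_apply]
    rw [hk k hkC.1 y hy1 (by linarith), hk' k hkC.2 (g y) b.1 b.2]
  inv_mem' := by
    rintro h ⟨hm, hl⟩
    refine ⟨strictMono_inv hm, fun x => ?_⟩
    obtain ⟨C, hC, h0, δ, hδ, hk⟩ := hl (h⁻¹ x)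
    obtain ⟨ε, hε, hc⟩ := right_cont (strictMono_inv hm) x hδ
    refine ⟨C, hC, h0, ε, hε, ?_⟩
    intro k hkC y hy1 hy2
    have b := hc y hy1 hy2
    have := hk k hkC (h⁻¹ y) b.1 b.2
    rw [perm_apply_inv] at this
    rw [← this, perm_inv_apply]

theorem loc_pc (s : Setup P H) {C : Set ℤ} (hC : BB P H C) (p : Q) : Loc P H (pc C p) := by
  intro x
  have hδ : (0 : ℚ) < 5 + 6 * blk x - x := by linarith [lt_blk x]
  have hb : ∀ y : D, (x : ℚ) ≤ y → (y : ℚ) < x + (5 + 6 * blk x - x) → blk y = blk x := by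
    intro y h1 h2
    apply blk_eq
    · linarith [blk_le x]
    · linarith
  by_cases hx : blk x ∈ C
  · refine ⟨{k | k - (-blk x) ∈ C}, BB.shift s hC _, by simpa using hx, _, hδ, ?_⟩
    intro k hk y h1 h2
    have hy := hb y h1 h2
    obtain ⟨z, j, hz, rfl⟩ := exists_blk y
    rw [blk_tr, hz, zero_add] at hy
    have hk' : k + j ∈ C := by
      rw [hy]; simpa using hk
    rw [tr_tr, ← mul_add, pc_mem p hz hk', pc_mem p hz (by rwa [hy]), tr_tr, mul_add]
  · refine ⟨{k | k - (-blk x) ∈ Cᶜ}, BB.shift s (BB.compl s hC) _, by simpa using hx, _, hδ, ?_⟩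
    intro k hk y h1 h2
    have hy := hb y h1 h2
    rw [pc_notMem p, pc_notMem p]
    · rwa [hy]
    · rw [blk_tr, hy, add_comm]; simpa using hk

theorem H_le_LocG (s : Setup P H) : H ≤ LocG s := by
  apply s.gen
  · refine ⟨tr_strictMono 1, fun x => ⟨_, BB.univ s, trivial, 1, one_pos, fun k _ y _ _ => ?_⟩⟩
    exact tr_mem_Per 1 k y
  · exact fun p _ => ⟨pc_strictMono _ _, loc_pc s (BB.univ s) p⟩
  · exact fun p _ => ⟨pc_strictMono _ _, loc_pc s (BB.C1 s) p⟩

end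

end IFE


namespace IFE

open scoped commutatorElement

section
variable {P : Subgroup Q} {H N : Subgroup (Equiv.Perm D)}

theorem f0_ne {x : D} (h0 : (0 : ℚ) ≤ x) (h1 : (x : ℚ) < 1) : f0.1 x ≠ x := by
  intro h
  have h' : F0 x = x := congrArg Subtype.val h
  unfold F0 at h'
  split_ifs at h' <;> linarith

theorem tr_eq_of_blk {x y : D} (hx : blk x = 0) (hy : blk y = 0) {j : ℤ} (h : x = tr (6 * j) y) :
    x = y := by
  have : blk x = j := by rw [h, blk_tr, hy, zero_add]
  rw [hx] at this
  subst this
  simpa [tr_zero] using h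

theorem simple_step1 (s : Setup P H) (hN : N ≤ H) (hnorm : ∀ h ∈ H, ∀ n ∈ N, h * n * h⁻¹ ∈ N)
    (hne : N ≠ ⊥) : ∃ n ∈ N, ∃ x : D, ∀ k, n x ≠ tr (6 * k) x := by
  obtain ⟨a0, ha0⟩ := Subgroup.ne_bot_iff_exists_ne_one.1 hne
  obtain ⟨n0, hn0, hn1⟩ : ∃ n0 : Equiv.Perm D, n0 ∈ N ∧ n0 ≠ 1 :=
    ⟨a0, a0.2, fun h => ha0 (Subtype.ext h)⟩
  obtain ⟨x, hx⟩ : ∃ x, n0 x ≠ x := by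
    by_contra hc
    push Not at hc
    exact hn1 (Equiv.ext hc)
  by_cases hall : ∀ k, n0 x ≠ tr (6 * k) x
  · exact ⟨n0, hn0, x, hall⟩
  push Not at hall
  obtain ⟨k, hk⟩ := hall
  have hk0 : k ≠ 0 := by
    rintro rfl
    apply hx
    simpa [tr_zero] using hk
  -- move `x` to `[0,1)`
  set i : ℤ := -⌊(x : ℚ)⌋ with hi
  have y0 : (0 : ℚ) ≤ (tr i x : D) := by
    rw [tr_coe, hi]; push_cast; linarith [Int.floor_le (x : ℚ)]
  have y1 : ((tr i x : D) : ℚ) < 1 := by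
    rw [tr_coe, hi]; push_cast; linarith [Int.lt_floor_add_one (x : ℚ)]
  set y := tr i x with hy
  have hn : tr i * n0 * (tr i)⁻¹ ∈ N := hnorm _ (s.tr_mem i) _ hn0
  set n := tr i * n0 * (tr i)⁻¹ with hnd
  have hny : n y = tr (6 * k) y := by
    rw [hnd, hy]
    simp only [Equiv.Perm.mul_apply, perm_inv_apply]
    rw [hk, tr_tr, tr_tr, add_comm]
  have hby : blk y = 0 := blk_zero_iff.2 ⟨by linarith, by linarith⟩
  obtain ⟨a, ha⟩ := C1_sep hk0
  have hC : BB P H {j | j - (-a) ∈ C1} := BB.shift s (BB.C1 s) _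
  set C : Set ℤ := {j | j - (-a) ∈ C1} with hCd
  have hc0 : (0 : ℤ) ∈ C ↔ a ∈ C1 := by simp [hCd]
  have hck : k ∈ C ↔ a + k ∈ C1 := by simp [hCd, add_comm]
  rw [← hc0, ← hck] at ha
  have hh := hC.2 f0 s.f0m
  have hty : tr (6 * 0) y = y := by simp [tr_zero]
  refine ⟨_, hnorm _ hh _ hn, pc C f0 y, fun j hj => ?_⟩
  simp only [Equiv.Perm.mul_apply, perm_inv_apply] at hj
  rw [hny] at hj
  by_cases h0 : (0 : ℤ) ∈ C
  · have hkC : k ∉ C := fun h => ha ⟨fun _ => h, fun _ => h0⟩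
    rw [pc_notMem f0 (by rwa [blk_tr, hby, zero_add])] at hj
    have e := pc_mem f0 hby h0
    rw [hty] at e
    rw [e, mul_zero, tr_zero, Equiv.Perm.one_apply] at hj
    have e2 := tr_solve hj.symm
    exact f0_ne y0 y1 (tr_eq_of_blk hby (Q_blk f0 hby) e2).symm
  · have hkC : k ∈ C := by
      by_contra h
      exact ha ⟨fun h' => absurd h' h0, fun h' => absurd h' h⟩
    rw [pc_notMem f0 (x := y) (by rwa [hby]), pc_mem f0 hby hkC] at hj
    have e2 := tr_solve hj.symm
    exact f0_ne y0 y1 (tr_eq_of_blk (Q_blk f0 hby) hby e2)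

/-- The support of a conjugate. -/
theorem supp_conj (s : Setup P H) {ℓ : Equiv.Perm D} (hℓ : ℓ ∈ LL) {C : Set ℤ} {p : Q}
    (hp : p ∈ P) {x : D} {δ : ℚ} (hW : ∀ y : D, -1 ≤ (y : ℚ) → (y : ℚ) < 4 →
      (x : ℚ) ≤ (ℓ y : D) ∧ ((ℓ y : D) : ℚ) < x + δ) {z : D} (hz : (ℓ * pc C p * ℓ⁻¹) z ≠ z) :
    ∃ k ∈ C, ∃ w : D, (x : ℚ) ≤ w ∧ (w : ℚ) < x + δ ∧ z = tr (6 * k) w := by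
  have h1 : pc C p (ℓ⁻¹ z) ≠ ℓ⁻¹ z := by
    intro h
    apply hz
    simp only [Equiv.Perm.mul_apply]
    rw [h, perm_apply_inv]
  obtain ⟨y, k, hy, hk⟩ := exists_blk (ℓ⁻¹ z)
  have hkC : k ∈ C := by
    by_contra hc
    apply h1
    apply pc_notMem
    rwa [hk, blk_tr, hy, zero_add]
  rw [hk, pc_mem p hy hkC] at h1
  have hI : -1 ≤ (y : ℚ) ∧ (y : ℚ) < 4 := by
    by_contra hc
    exact h1 (by rw [s.supp p hp y hc])
  refine ⟨k, hkC, ℓ y, (hW y hI.1 hI.2).1, (hW y hI.1 hI.2).2, ?_⟩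
  rw [← LL_le_Per hℓ, ← hk, perm_apply_inv]

theorem simple_step2 (s : Setup P H) (hN : N ≤ H) (hnorm : ∀ h ∈ H, ∀ n ∈ N, h * n * h⁻¹ ∈ N)
    (hne : N ≠ ⊥) : ∃ C, BB P H C ∧ 0 ∈ C ∧ ∀ p ∈ P, pc C p ∈ N := by
  obtain ⟨n, hn, x, hx⟩ := simple_step1 s hN hnorm hne
  obtain ⟨hmono, hloc⟩ := H_le_LocG s (hN hn)
  obtain ⟨C, hC, h0, δ, hδ, hk⟩ := hloc x
  refine ⟨C, hC, h0, ?_⟩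
  -- displacement
  set j := ⌊(((n x : D) : ℚ) - x) / 6⌋ with hj
  have j1 : (j : ℚ) ≤ (((n x : D) : ℚ) - x) / 6 := Int.floor_le _
  have j2 : (((n x : D) : ℚ) - x) / 6 < j + 1 := Int.lt_floor_add_one _
  have j3 : (0 : ℚ) < ((n x : D) : ℚ) - x - 6 * j := by
    have : ((n x : D) : ℚ) ≠ x + 6 * j := by
      intro h
      apply hx j
      apply Subtype.ext
      rw [h, tr_coe]; push_cast; ring
    have h2 : x + 6 * (j : ℚ) ≤ ((n x : D) : ℚ) := by linarith
    have := lt_of_le_of_ne h2 this.symm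
    linarith
  obtain ⟨ε, hε, hc⟩ := right_cont hmono x
    (show (0 : ℚ) < 6 * j + 6 - (((n x : D) : ℚ) - x) by linarith)
  obtain ⟨δ', hδ', d1, d2, d3⟩ : ∃ δ' : ℚ, 0 < δ' ∧ δ' ≤ δ ∧ δ' ≤ ε ∧
      δ' ≤ ((n x : D) : ℚ) - x - 6 * j :=
    ⟨min δ (min ε (((n x : D) : ℚ) - x - 6 * j)), lt_min hδ (lt_min hε j3), min_le_left _ _,
      le_trans (min_le_right _ _) (min_le_left _ _), le_trans (min_le_right _ _) (min_le_right _ _)⟩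
  have hdis : ∀ (y z : D) (k : ℤ), (x : ℚ) ≤ y → (y : ℚ) < x + δ' → (x : ℚ) ≤ z →
      (z : ℚ) < x + δ' → n y ≠ tr (6 * k) z := by
    intro y z k y1 y2 z1 z2 he
    have b := hc y y1 (by linarith)
    rw [he, tr_coe] at b
    obtain ⟨b1, b2⟩ := b
    push_cast at b1 b2
    have c1 : (j : ℚ) < k := by linarith
    have c2 : (k : ℚ) < j + 1 := by linarith
    have c1' : j < k := by exact_mod_cast c1
    have c2' : k < j + 1 := by exact_mod_cast c2
    omega
  obtain ⟨ℓ, hℓ, hW⟩ := mobile x hδ'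
  have hℓH := s.LL_le hℓ
  apply s.key N C
  · intro m hm
    have := hnorm _ (H.inv_mem s.mm_mem) m hm
    rwa [inv_inv] at this
  · exact fun m hm => hnorm _ (s.tr_mem 2) m hm
  intro p hp q hq
  rw [show C = C ∩ C by simp, ← pc_comm]
  set a := ℓ * pc C p * ℓ⁻¹ with ha
  set b := ℓ * pc C q * ℓ⁻¹ with hb
  have haH : a ∈ H := H.mul_mem (H.mul_mem hℓH (hC.2 p hp)) (H.inv_mem hℓH)
  have hbH : b ∈ H := H.mul_mem (H.mul_mem hℓH (hC.2 q hq)) (H.inv_mem hℓH)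
  have hdj : Equiv.Perm.Disjoint (n * a * n⁻¹) b := by
    intro z
    by_contra hc
    push Not at hc
    obtain ⟨c1, c2⟩ := hc
    obtain ⟨k', hk', w', w1', w2', hw'⟩ := supp_conj s hℓ hq hW c2
    have c3 : a (n⁻¹ z) ≠ n⁻¹ z := by
      intro h
      apply c1
      simp only [Equiv.Perm.mul_apply]
      rw [h, perm_apply_inv]
    obtain ⟨k, hkC, w, w1, w2, hw⟩ := supp_conj s hℓ hp hW c3
    have e1 : z = tr (6 * k) (n w) := by
      rw [← hk k hkC w w1 (by linarith), ← hw, perm_apply_inv]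
    rw [e1] at hw'
    apply hdis w w' (-k + k') w1 w2 w1' w2'
    have := congrArg (tr (6 * -k)) hw'
    rw [tr_tr, tr_tr, ← mul_add, ← mul_add, neg_add_cancel, mul_zero, tr_zero] at this
    exact this
  have hcomm : Commute (n * a * n⁻¹) b := hdj.commute
  have hcN : a * (n * a * n⁻¹)⁻¹ ∈ N := by
    have h1 := hnorm a haH n hn
    have h2 := N.mul_mem h1 (N.inv_mem hn)
    have e : a * (n * a * n⁻¹)⁻¹ = a * n * a⁻¹ * n⁻¹ := by group
    rw [e]; exact h2
  have hab : ⁅a, b⁆ ∈ N := by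
    set a' := n * a * n⁻¹ with ha'
    have h1 := hnorm b hbH _ (N.inv_mem hcN)
    have h2 := N.mul_mem hcN h1
    have e : ⁅a, b⁆ = a * a'⁻¹ * (b * (a * a'⁻¹)⁻¹ * b⁻¹) := by
      have hc2 : a'⁻¹ * b * a' = b := by
        rw [mul_assoc, ← hcomm.eq, ← mul_assoc, inv_mul_cancel, one_mul]
      calc ⁅a, b⁆ = a * b * a⁻¹ * b⁻¹ := rfl
        _ = a * (a'⁻¹ * b * a') * a⁻¹ * b⁻¹ := by rw [hc2]
        _ = _ := by group
    rw [e]; exact h2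
  have := hnorm _ (H.inv_mem hℓH) _ hab
  have e : ℓ⁻¹ * ⁅a, b⁆ * ℓ⁻¹⁻¹ = ⁅pc C p, pc C q⁆ := by
    rw [ha, hb, commutatorElement_def, commutatorElement_def]; group
  rwa [e] at this

theorem simple_step3 (s : Setup P H) (hN : N ≤ H) (hnorm : ∀ h ∈ H, ∀ n ∈ N, h * n * h⁻¹ ∈ N)
    (hne : N ≠ ⊥) : H ≤ N := by
  obtain ⟨C, hC, h0, hCN⟩ := simple_step2 s hN hnorm hne
  have hinter : ∀ E F, BB P H F → (∀ p ∈ P, pc E p ∈ N) → ∀ p ∈ P, pc (E ∩ F) p ∈ N := by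
    intro E F hF hE
    apply s.key N
    · intro m hm
      have := hnorm _ (H.inv_mem s.mm_mem) m hm
      rwa [inv_inv] at this
    · exact fun m hm => hnorm _ (s.tr_mem 2) m hm
    · intro p hp q hq
      rw [← pc_comm, commutatorElement_def]
      have h1 := hnorm _ (hF.2 q hq) _ (N.inv_mem (hE p hp))
      have := N.mul_mem (hE p hp) h1
      simpa only [mul_assoc] using this
  obtain ⟨M, hM, hM'⟩ := hC.1 0
  have hMC : ∀ j, M * j ∈ C := fun j => by
    have := (hM' j).2 h0
    rwa [zero_add] at this
  have hU : ∀ m : ℕ, ∃ U : Set ℤ, BB P H U ∧ (∀ p ∈ P, pc U p ∈ N) ∧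
      ∀ i : ℕ, i < m → ∀ j : ℤ, M * j + i ∈ U := by
    intro m
    induction m with
    | zero =>
      refine ⟨∅, ⟨fun k => ⟨1, one_pos, fun j => by simp⟩, fun p _ => ?_⟩, fun p _ => ?_, fun i hi => by omega⟩
      · rw [pc_empty]; exact H.one_mem
      · rw [pc_empty]; exact N.one_mem
    | succ m ih =>
      obtain ⟨U, hU, hUN, hUm⟩ := ih
      have hS := BB.shift s hC (m : ℤ)
      have hSN : ∀ p ∈ P, pc {k : ℤ | k - (m : ℤ) ∈ C} p ∈ N := fun p hp => by
        rw [← tr_conj_pc]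
        exact hnorm _ (s.tr_mem _) _ (hCN p hp)
      have hT := hinter _ _ (BB.compl s hU) hSN
      refine ⟨U ∪ {k : ℤ | k - (m : ℤ) ∈ C}, ?_, ?_, ?_⟩
      · have := BB.compl s (BB.inter s (BB.compl s hU) (BB.compl s hS))
        rwa [← Set.compl_union, compl_compl] at this
      · intro p hp
        rw [← pc_union]
        exact N.mul_mem (hUN p hp) (hT p hp)
      · intro i hi j
        rcases Nat.lt_succ_iff_lt_or_eq.1 hi with h | h
        · exact Or.inl (hUm i h j)
        · right
          subst h
          show M * j + i - i ∈ C
          rw [add_sub_cancel_right]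
          exact hMC j
  obtain ⟨U, hU, hUN, hUm⟩ := hU M.toNat
  have hUu : U = Set.univ := by
    apply Set.eq_univ_of_forall
    intro k
    have h1 := Int.emod_nonneg k hM.ne'
    have h2 := Int.emod_lt_of_pos k hM
    have h3 := hUm (k % M).toNat (by omega) (k / M)
    rw [Int.toNat_of_nonneg h1, Int.mul_ediv_add_emod] at h3
    exact h3
  subst hUu
  have hcN : ∀ p ∈ P, pc C1 p ∈ N := by
    have := hinter Set.univ C1 (BB.C1 s) hUN
    rwa [Set.univ_inter] at this
  refine s.gen N ?_ hUN hcN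
  -- `σ`
  haveI : (N.subgroupOf H).Normal := ⟨fun n hn g => hnorm g.1 g.2 n.1 hn⟩
  have h1 : (⟨f, s.um _ s.f0m⟩ : H) ∈ N.subgroupOf H := hUN f0 s.f0m
  have h2 := σ_mem_of_normal (N.subgroupOf H) (s := (⟨σ, s.σm⟩ : H)) (g := ⟨f, s.um _ s.f0m⟩)
    (Subtype.ext rel_σf) h1
  exact h2

theorem simple_H (s : Setup P H) : IsSimpleGroup H := by
  haveI : Nontrivial H := by
    refine ⟨⟨⟨σ, s.σm⟩, 1, fun h => ?_⟩⟩
    have h1 : σ = 1 := congrArg Subtype.val h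
    have h2 := σ_coe 0
    rw [h1] at h2
    simp at h2
  refine ⟨fun N hN => ?_⟩
  by_cases hb : N = ⊥
  · exact Or.inl hb
  right
  have h := simple_step3 (N := N.map H.subtype) s (Subgroup.map_subtype_le N) ?_ ?_
  · rw [eq_top_iff]
    intro x _
    obtain ⟨y, hy, he⟩ := h x.2
    have : y = x := Subtype.ext he
    rwa [← this]
  · rintro h hh _ ⟨n, hn, rfl⟩
    exact ⟨⟨h, hh⟩ * n * ⟨h, hh⟩⁻¹, hN.conj_mem n hn _, rfl⟩
  · intro he
    apply hb
    rwa [Subgroup.map_eq_bot_iff_of_injective _ H.subtype_injective] at he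

theorem lo_H (s : Setup P H) : IsLeftOrderable H :=
  leftOrderable_of_action H.subtype H.subtype_injective (fun k => (H_le_LocG s k.2).1)

end

end IFE


namespace IFE

open scoped commutatorElement

section
variable {Γ : Type} [Group Γ]

def TS (r : Γ →* Q) (S : Finset Γ) : Set Q := {f0, f2} ∪ r '' (S : Set Γ)

def PP (r : Γ →* Q) : Subgroup Q := Subgroup.closure ({f0, f2} ∪ Set.range r)

def Y0 (r : Γ →* Q) (S : Finset Γ) : Set (Equiv.Perm D) :=
  {σ} ∪ (pc Set.univ '' TS r S ∪ pc C1 '' TS r S)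

theorem Y0_finite (r : Γ →* Q) (S : Finset Γ) : (Y0 r S).Finite := by
  have h : (TS r S).Finite := (Set.toFinite {f0, f2}).union (S.finite_toSet.image r)
  exact (Set.finite_singleton _).union ((h.image _).union (h.image _))

theorem PP_le (r : Γ →* Q) (S : Finset Γ) (hS : Generates S) (K : Subgroup Q)
    (h : TS r S ⊆ K) : PP r ≤ K := by
  unfold PP
  rw [Subgroup.closure_le]
  rintro p (hp | ⟨γ, rfl⟩)
  · exact h (Or.inl hp)
  · have h1 : Subgroup.closure (S : Set Γ) ≤ K.comap r := by
      rw [Subgroup.closure_le]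
      intro s hs
      exact h (Or.inr ⟨s, hs, rfl⟩)
    rw [hS] at h1
    exact h1 (Subgroup.mem_top γ)

theorem TS_sub (r : Γ →* Q) (S : Finset Γ) : TS r S ⊆ PP r := by
  rintro p (hp | ⟨s, _, rfl⟩)
  · exact Subgroup.subset_closure (Or.inl hp)
  · exact Subgroup.subset_closure (Or.inr ⟨s, rfl⟩)

theorem F0_supp {q : ℚ} (h : ¬ (-1 ≤ q ∧ q < 2)) : F0 q = q := by
  unfold F0
  split_ifs with h1 h2 h3
  · rfl
  · exact absurd ⟨by linarith, by linarith⟩ h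
  · exact absurd ⟨by linarith, by linarith⟩ h
  · rfl

theorem setup (r : Γ →* Q) (S : Finset Γ) (hS : Generates S) (hperf : commutator Γ = ⊤)
    (hr : ∀ γ (x : D), ¬ ((0 : ℚ) < x ∧ (x : ℚ) < 8 / 3) → (r γ).1 x = x) :
    Setup (PP r) (Subgroup.closure (Y0 r S)) where
  f0m := TS_sub r S (Or.inl (by simp))
  key := by
    intro M E h1 h2 h3
    have hf0 : f0 ∈ PP r := Subgroup.subset_closure (Or.inl (by simp))
    have hf2 : f2 ∈ PP r := Subgroup.subset_closure (Or.inl (by simp))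
    have a1 : pc E fstar ∈ M := h3 _ hf2 _ hf0
    have a2 : pc E f0 ∈ M := by
      have := h1 _ a1
      rw [← mm_conj] at this
      have e : mm⁻¹ * (mm * pc E f0 * mm⁻¹) * mm = pc E f0 := by group
      rwa [e] at this
    have a3 : pc E f2 ∈ M := by
      have := h2 _ a2
      rwa [tr2_conj] at this
    have a4 : commutator Γ ≤ M.comap ((pc E).comp r) := by
      rw [commutator_eq_closure, Subgroup.closure_le]
      rintro _ ⟨a, b, rfl⟩
      show pc E (r ⁅a, b⁆) ∈ M
      rw [map_commutatorElement]
      exact h3 _ (Subgroup.subset_closure (Or.inr ⟨a, rfl⟩)) _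
        (Subgroup.subset_closure (Or.inr ⟨b, rfl⟩))
    rw [hperf] at a4
    have a5 : PP r ≤ M.comap (pc E) := by
      unfold PP
      rw [Subgroup.closure_le]
      rintro p ((rfl | rfl) | ⟨γ, rfl⟩)
      · exact a2
      · exact a3
      · exact a4 (Subgroup.mem_top γ)
    exact fun p hp => a5 hp
  supp := by
    intro p hp x hx
    have a5 : PP r ≤ (MulAction.stabilizer (Equiv.Perm D) x).comap Q.subtype := by
      unfold PP
      rw [Subgroup.closure_le]
      rintro p ((rfl | rfl) | ⟨γ, rfl⟩)
      · show f0.1 x = x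
        apply Subtype.ext
        rw [f0_coe]
        exact F0_supp (fun h => hx ⟨by linarith [h.1], by linarith [h.2]⟩)
      · show f2.1 x = x
        apply Subtype.ext
        rw [f2_coe, F0_supp (fun h => hx ⟨by linarith [h.1], by linarith [h.2]⟩)]
        ring
      · exact hr γ x (fun h => hx ⟨by linarith [h.1], by linarith [h.2]⟩)
    exact a5 hp
  σm := Subgroup.subset_closure (Or.inl rfl)
  um := fun p hp => PP_le r S hS ((Subgroup.closure (Y0 r S)).comap (pc Set.univ))
    (fun q hq => Subgroup.subset_closure (Or.inr (Or.inl ⟨q, hq, rfl⟩))) hp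
  cm := fun p hp => PP_le r S hS ((Subgroup.closure (Y0 r S)).comap (pc C1))
    (fun q hq => Subgroup.subset_closure (Or.inr (Or.inr ⟨q, hq, rfl⟩))) hp
  gen := by
    intro K h1 h2 h3
    rw [Subgroup.closure_le]
    rintro x (hx | ⟨p, hp, rfl⟩ | ⟨p, hp, rfl⟩)
    · rw [Set.mem_singleton_iff.1 hx]; exact h1
    · exact h2 p (TS_sub r S hp)
    · exact h3 p (TS_sub r S hp)

/-! ### Germs -/

structure Good (ρ : Γ →* Equiv.Perm D) : Prop where
  out : ∀ γ (x : D), ¬ ((0 : ℚ) < x ∧ (x : ℚ) < 8 / 3) → ρ γ x = x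
  mono : ∀ γ, StrictMono (ρ γ)
  half : ∀ γ (x y : D), (0 : ℚ) < x ∧ (x : ℚ) < 8 / 3 → (y : ℚ) = x / 2 →
        (ρ γ y : ℚ) = (ρ γ x) / 2
  affine : ∀ γ (x : D), (0 : ℚ) < x ∧ (x : ℚ) < 8 / 3 →
        ∃ k : ℤ, ∃ δ : ℚ, 0 < δ ∧ ∀ y : D, (x : ℚ) ≤ y → (y : ℚ) < x + δ →
          (ρ γ y : ℚ) = ρ γ x + 2 ^ k * ((y : ℚ) - x)
  faithful : ∀ γ, (∃ δ : ℚ, 0 < δ ∧ ∃ k : ℤ, ∀ x : D, (0 : ℚ) < x → (x : ℚ) < δ →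
        (ρ γ x : ℚ) = 2 ^ k * x) → γ = 1

def Germ (ρ : Γ →* Equiv.Perm D) (h : Equiv.Perm D) (x : D) (γ : Γ) : Prop :=
  ∃ k : ℤ, ∃ δ : ℚ, 0 < δ ∧ ∀ e : D, (0 : ℚ) < e → (e : ℚ) < δ →
    ((h (x + e) : D) : ℚ) = (h x : D) + 2 ^ k * (ρ γ e : D)

variable {ρ : Γ →* Equiv.Perm D}

theorem Good.zero (g : Good ρ) (γ : Γ) : ρ γ 0 = 0 := g.out γ 0 (fun h => lt_irrefl _ h.1)

theorem Good.pos (g : Good ρ) (γ : Γ) {e : D} (he : (0 : ℚ) < e) : (0 : ℚ) < (ρ γ e : D) := by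
  have := g.mono γ (show (0 : D) < e from he)
  rw [g.zero] at this
  exact this

theorem Good.small (g : Good ρ) (γ : Γ) {η : ℚ} (hη : 0 < η) : ∃ δ : ℚ, 0 < δ ∧
    ∀ e : D, (0 : ℚ) < e → (e : ℚ) < δ → ((ρ γ e : D) : ℚ) < η := by
  obtain ⟨δ, hδ, h⟩ := right_cont (g.mono γ) 0 hη
  refine ⟨δ, hδ, fun e h1 h2 => ?_⟩
  have := (h e h1.le (by simpa using h2)).2
  rw [g.zero] at this
  simpa using this

noncomputable def zsc (k : ℤ) (x : D) : D := ⟨2 ^ k * (x : ℚ), dyadic.mul_mem (two_zpow_mem k) x.2⟩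

theorem zsc_coe (k : ℤ) (x : D) : (zsc k x : ℚ) = 2 ^ k * x := rfl

theorem Good.scale_nat (g : Good ρ) (γ : Γ) (n : ℕ) : ∀ {x y : D}, (0 : ℚ) < x → (x : ℚ) < 8 / 3 →
    (2 : ℚ) ^ n * y = x → (2 : ℚ) ^ n * (ρ γ y : D) = (ρ γ x : D) := by
  induction n with
  | zero =>
    intro x y _ _ h
    have : y = x := Subtype.ext (by simpa using h)
    rw [this]; simp
  | succ n ih =>
    intro x y h0 h1 h
    have hp : (0 : ℚ) < 2 ^ n := by positivity
    have hy0 : (0 : ℚ) < y := by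
      by_contra hc
      have : (2 : ℚ) ^ (n + 1) * y ≤ 0 := mul_nonpos_of_nonneg_of_nonpos (by positivity) (not_lt.1 hc)
      linarith
    obtain ⟨z, hz⟩ : ∃ z : D, (z : ℚ) = x / 2 := ⟨zsc (-1) x, by rw [zsc_coe]; norm_num; ring⟩
    have h2 := g.half γ x z ⟨h0, h1⟩ hz
    have h3 := ih (x := z) (y := y) (by linarith) (by linarith) (by rw [hz, ← h, pow_succ]; ring)
    rw [pow_succ]
    linarith

theorem Good.scale (g : Good ρ) (γ : Γ) (k : ℤ) {x : D} (h0 : (0 : ℚ) < x) (h1 : (x : ℚ) < 8 / 3)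
    (h2 : (zsc k x : ℚ) < 8 / 3) : ((ρ γ (zsc k x) : D) : ℚ) = 2 ^ k * (ρ γ x : D) := by
  have hp : (0 : ℚ) < (zsc k x : ℚ) := by rw [zsc_coe]; positivity
  obtain ⟨n, rfl | rfl⟩ := k.eq_nat_or_neg
  · rw [zpow_natCast]
    exact (g.scale_nat γ n hp h2 (by rw [zsc_coe, zpow_natCast])).symm
  · have := g.scale_nat γ n h0 h1 (y := zsc (-n) x) (by
      rw [zsc_coe, zpow_neg, zpow_natCast]; field_simp)
    rw [← this, zpow_neg, zpow_natCast]
    field_simp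

theorem Germ.uniq (g : Good ρ) {h : Equiv.Perm D} {x : D} {a b : Γ} (ha : Germ ρ h x a)
    (hb : Germ ρ h x b) : a = b := by
  obtain ⟨k, δ, hδ, hk⟩ := ha
  obtain ⟨k', δ', hδ', hk'⟩ := hb
  obtain ⟨ε, hε, hs⟩ := g.small a⁻¹ (lt_min hδ hδ')
  have : b * a⁻¹ = 1 := by
    apply g.faithful
    refine ⟨ε, hε, k - k', fun e e0 e1 => ?_⟩
    have h1 := lt_min_iff.1 (hs e e0 e1)
    have h2 := g.pos a⁻¹ e0
    have e1 := hk _ h2 h1.1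
    have e2 := hk' _ h2 h1.2
    rw [map_inv, perm_apply_inv, ← map_inv] at e1
    rw [map_mul, Equiv.Perm.mul_apply]
    have e3 : (2 : ℚ) ^ k * e = 2 ^ k' * (ρ b (ρ a⁻¹ e) : D) := by linarith
    rw [zpow_sub₀ (by norm_num), div_mul_eq_mul_div, e3]
    field_simp
  exact (mul_inv_eq_one.1 this).symm

theorem Germ.one (ρ : Γ →* Equiv.Perm D) (x : D) : Germ ρ 1 x 1 :=
  ⟨0, 1, one_pos, fun e _ _ => by simp⟩

theorem Germ.mul (g : Good ρ) {h k : Equiv.Perm D} {x : D} {a b : Γ} (ha : Germ ρ h (k x) a)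
    (hb : Germ ρ k x b) : Germ ρ (h * k) x (a * b) := by
  obtain ⟨i, δ, hδ, hi⟩ := ha
  obtain ⟨j, δ', hδ', hj⟩ := hb
  have hp : (0 : ℚ) < 2 ^ j := by positivity
  obtain ⟨ε, hε, hs⟩ := g.small b (η := min (8 / 3) (min (8 / 3 / 2 ^ j) (δ / 2 ^ j)))
    (lt_min (by norm_num) (lt_min (by positivity) (by positivity)))
  refine ⟨i + j, min δ' ε, lt_min hδ' hε, fun e e0 e1 => ?_⟩
  obtain ⟨e1, e2⟩ := lt_min_iff.1 e1
  obtain ⟨s1, s2⟩ := lt_min_iff.1 (hs e e0 e2)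
  obtain ⟨s2, s3⟩ := lt_min_iff.1 s2
  have s0 := g.pos b e0
  rw [lt_div_iff₀ hp] at s2 s3
  have hke : k (x + e) = k x + zsc j (ρ b e) := Subtype.ext (hj e e0 e1)
  have z0 : (0 : ℚ) < zsc j (ρ b e) := by rw [zsc_coe]; positivity
  have z1 := hi (zsc j (ρ b e)) z0 (by rw [zsc_coe]; linarith)
  rw [g.scale a j s0 s1 (by rw [zsc_coe]; linarith)] at z1
  simp only [Equiv.Perm.mul_apply, map_mul]
  rw [hke, z1, zpow_add₀ (by norm_num)]
  ring

theorem Germ.inv (g : Good ρ) {h : Equiv.Perm D} {x : D} {a : Γ} (ha : Germ ρ h x a) :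
    Germ ρ h⁻¹ (h x) a⁻¹ := by
  obtain ⟨k, δ, hδ, hk⟩ := ha
  have hp : (0 : ℚ) < 2 ^ (-k) := by positivity
  obtain ⟨ε, hε, hs⟩ := g.small a⁻¹ (η := min (8 / 3) (min (8 / 3 / 2 ^ (-k)) (δ / 2 ^ (-k))))
    (lt_min (by norm_num) (lt_min (by positivity) (by positivity)))
  refine ⟨-k, ε, hε, fun e e0 e1 => ?_⟩
  obtain ⟨s1, s2⟩ := lt_min_iff.1 (hs e e0 e1)
  obtain ⟨s2, s3⟩ := lt_min_iff.1 s2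
  have s0 := g.pos a⁻¹ e0
  rw [lt_div_iff₀ hp] at s2 s3
  have z0 : (0 : ℚ) < zsc (-k) (ρ a⁻¹ e) := by rw [zsc_coe]; positivity
  have z1 := hk (zsc (-k) (ρ a⁻¹ e)) z0 (by rw [zsc_coe]; linarith)
  rw [g.scale a (-k) s0 s1 (by rw [zsc_coe]; linarith)] at z1
  rw [map_inv, perm_apply_inv, ← map_inv, zpow_neg, mul_inv_cancel_left₀ (by positivity)] at z1
  have e2 : h (x + zsc (-k) (ρ a⁻¹ e)) = h x + e := Subtype.ext z1
  rw [← e2, perm_inv_apply, perm_inv_apply]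
  rfl

theorem germ_affine {h : Equiv.Perm D} {x : D} (hx : ∃ k : ℤ, ∃ δ : ℚ, 0 < δ ∧ ∀ y : D,
    (x : ℚ) ≤ y → (y : ℚ) < x + δ → ((h y : D) : ℚ) = (h x : D) + 2 ^ k * ((y : ℚ) - x)) :
    Germ ρ h x 1 := by
  obtain ⟨k, δ, hδ, hk⟩ := hx
  refine ⟨k, δ, hδ, fun e e0 e1 => ?_⟩
  have hc : ((x + e : D) : ℚ) = x + e := rfl
  rw [hk (x + e) (by rw [hc]; linarith) (by rw [hc]; linarith), hc]
  simp

theorem germ_fix {h : Equiv.Perm D} {x : D} (hx : ∃ δ : ℚ, 0 < δ ∧ ∀ y : D,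
    (x : ℚ) ≤ y → (y : ℚ) < x + δ → h y = y) : Germ ρ h x 1 := by
  obtain ⟨δ, hδ, hk⟩ := hx
  apply germ_affine
  refine ⟨0, δ, hδ, fun y h1 h2 => ?_⟩
  rw [hk y h1 h2, hk x le_rfl (by linarith)]
  simp

theorem germ_pc (C : Set ℤ) (p : Q) (y : D) (hy : blk y = 0) (k : ℤ) {a : Γ}
    (ha : Germ ρ p.1 y a) :
    (k ∈ C ∧ Germ ρ (pc C p) (tr (6 * k) y) a) ∨ (k ∉ C ∧ Germ ρ (pc C p) (tr (6 * k) y) 1) := by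
  have hb := blk_zero_iff.1 hy
  by_cases hk : k ∈ C
  · left
    refine ⟨hk, ?_⟩
    obtain ⟨i, δ, hδ, hi⟩ := ha
    refine ⟨i, min δ (5 - y), lt_min hδ (by linarith [hb.2]), fun e e0 e1 => ?_⟩
    obtain ⟨e1, e2⟩ := lt_min_iff.1 e1
    have hc : ((y + e : D) : ℚ) = y + e := rfl
    have hbe : blk (y + e) = 0 := blk_zero_iff.2 ⟨by rw [hc]; linarith [hb.1],
      by rw [hc]; linarith⟩
    have e3 : tr (6 * k) y + e = tr (6 * k) (y + e) := by
      rw [tr_apply, tr_apply]; ring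
    rw [e3, pc_mem p hbe hk, pc_mem p hy hk, tr_coe, tr_coe, hi e e0 e1]
    ring
  · right
    refine ⟨hk, germ_fix ⟨5 - y, by linarith [hb.2], fun z z1 z2 => ?_⟩⟩
    apply pc_notMem
    have : blk z = k := by
      rw [tr_coe] at z1 z2
      push_cast at z1 z2
      exact blk_eq (by linarith [hb.1]) (by linarith)
    rwa [this]

theorem F0_aff (q : ℚ) : ∃ k : ℤ, ∃ δ : ℚ, 0 < δ ∧ ∀ q' : ℚ, q ≤ q' → q' < q + δ →
    F0 q' = F0 q + 2 ^ k * (q' - q) := by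
  by_cases h1 : q < -1
  · refine ⟨0, -1 - q, by linarith, fun q' a b => ?_⟩
    unfold F0
    rw [if_pos h1, if_pos (by linarith)]
    simp
  by_cases h2 : q < 0
  · refine ⟨1, -q, by linarith, fun q' a b => ?_⟩
    unfold F0
    rw [if_neg h1, if_pos h2, if_neg (by linarith), if_pos (by linarith)]
    norm_num; ring
  by_cases h3 : q < 2
  · refine ⟨-1, 2 - q, by linarith, fun q' a b => ?_⟩
    unfold F0
    rw [if_neg h1, if_neg h2, if_pos h3, if_neg (by linarith), if_neg (by linarith),
      if_pos (by linarith)]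
    norm_num; ring
  · refine ⟨0, 1, by linarith, fun q' a b => ?_⟩
    unfold F0
    rw [if_neg h1, if_neg h2, if_neg h3, if_neg (by linarith), if_neg (by linarith),
      if_neg (by linarith)]
    norm_num

theorem germ_f0 (x : D) : Germ ρ f0.1 x 1 := by
  obtain ⟨k, δ, hδ, hk⟩ := F0_aff x
  exact germ_affine ⟨k, δ, hδ, fun y h1 h2 => by rw [f0_coe, f0_coe]; exact hk y h1 h2⟩

theorem germ_f2 (x : D) : Germ ρ f2.1 x 1 := by
  obtain ⟨k, δ, hδ, hk⟩ := F0_aff (x - 2)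
  exact germ_affine ⟨k, δ, hδ, fun y h1 h2 => by
    rw [f2_coe, f2_coe, hk (y - 2) (by linarith) (by linarith)]; ring⟩

theorem germ_σ (x : D) : Germ ρ σ x 1 :=
  germ_affine ⟨0, 1, one_pos, fun y _ _ => by rw [σ_coe, σ_coe]; simp; ring⟩

theorem germ_base (g : Good ρ) (γ : Γ) : Germ ρ (ρ γ) 0 γ :=
  ⟨0, 1, one_pos, fun e _ _ => by rw [g.zero, zero_add]; simp⟩

theorem germ_ρ (g : Good ρ) (γ : Γ) (x : D) : Germ ρ (ρ γ) x 1 ∨ Germ ρ (ρ γ) x γ := by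
  by_cases h0 : (x : ℚ) < 0
  · left
    exact germ_fix ⟨-x, by linarith, fun y h1 h2 => g.out γ y (fun h => by linarith [h.1])⟩
  by_cases h8 : (x : ℚ) < 8 / 3
  · rcases (not_lt.1 h0).eq_or_lt with h | h
    · right
      have : x = 0 := Subtype.ext h.symm
      rw [this]; exact germ_base g γ
    · left
      exact germ_affine (g.affine γ x ⟨h, h8⟩)
  · left
    exact germ_fix ⟨1, one_pos, fun y h1 h2 => g.out γ y (fun h => by linarith [h.2])⟩

theorem stage2 (S : Finset Γ) (hS : Generates S) (hΓ : IsLeftOrderable Γ)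
    (hperf : commutator Γ = ⊤) :
    ∃ (H : Type) (_ : Group H) (Y : Finset H) (φ : Γ →* H), Generates Y ∧ IsLeftOrderable H ∧
      IsSimpleGroup H ∧ IsFrattini φ ∧ ∀ g, wordLength Y (φ g) = wordLength S g := by
  haveI := countable_of_generates hS
  obtain ⟨ρ, g1, g2, g3, g4, g5⟩ := tiles Γ hΓ
  have g : Good ρ := ⟨g1, g2, g3, g4, g5⟩
  let r : Γ →* Q := ρ.codRestrict Q (fun γ => ⟨g2 γ, fun x hx => g1 γ x (fun h => hx
    (blk_zero_iff.2 ⟨by linarith [h.1], by linarith [h.2]⟩))⟩)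
  have hr : ∀ γ, (r γ).1 = ρ γ := fun γ => rfl
  have s := setup r S hS hperf g1
  obtain ⟨Y, hY, hYm⟩ := finset_generates (Y0 r S) (Y0_finite r S)
  let φ : Γ →* Subgroup.closure (Y0 r S) := ((pc Set.univ).comp r).codRestrict _
    (fun γ => s.um _ (Subgroup.subset_closure (Or.inr ⟨γ, rfl⟩)))
  have hφ : ∀ γ, (φ γ).1 = pc Set.univ (r γ) := fun γ => rfl
  have b0 : blk 0 = 0 := blk_zero_iff.2 ⟨by norm_num, by norm_num⟩
  have h00 : tr (6 * 0) (0 : D) = 0 := by simp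
  have hφ0 : ∀ γ, (φ γ).1 0 = 0 := by
    intro γ
    have := pc_mem (r γ) b0 (Set.mem_univ 0)
    rw [h00, hr, g.zero, h00] at this
    exact this
  have hGp : ∀ (C : Set ℤ) (γ : Γ) (x : D), Germ ρ (pc C (r γ)) x 1 ∨ Germ ρ (pc C (r γ)) x γ := by
    intro C γ x
    obtain ⟨y, k, hy, rfl⟩ := exists_blk x
    rcases germ_ρ g γ y with h | h
    · rcases germ_pc C (r γ) y hy k h with h | h
      · exact Or.inl h.2
      · exact Or.inl h.2
    · rcases germ_pc C (r γ) y hy k h with h | h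
      · exact Or.inr h.2
      · exact Or.inl h.2
  have hG1 : ∀ (C : Set ℤ) (p : Q) (x : D), (∀ y, Germ ρ p.1 y 1) → Germ ρ (pc C p) x 1 := by
    intro C p x h
    obtain ⟨y, k, hy, rfl⟩ := exists_blk x
    rcases germ_pc C p y hy k (h y) with h | h <;> exact h.2
  have hT : ∀ (C : Set ℤ), ∀ p ∈ TS r S, ∀ x, ∃ a, Germ ρ (pc C p) x a ∧ (a = 1 ∨ a ∈ S) := by
    rintro C p ((rfl | rfl) | ⟨γ, hγ, rfl⟩) x
    · exact ⟨1, hG1 C _ x germ_f0, Or.inl rfl⟩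
    · exact ⟨1, hG1 C _ x germ_f2, Or.inl rfl⟩
    · rcases hGp C γ x with h | h
      · exact ⟨1, h, Or.inl rfl⟩
      · exact ⟨γ, h, Or.inr hγ⟩
  have main := cocycle_embedding (Ω := D) hS hY φ
    (fun x hx => (hYm _).2 (Or.inr (Or.inl ⟨r x, Or.inr ⟨x, hx, rfl⟩, rfl⟩)))
    (Subgroup.closure (Y0 r S)).subtype (fun h x a => Germ ρ h.1 x a)
    (fun _ _ _ _ ha hb => Germ.uniq g ha hb)
    (fun _ _ _ _ _ ha hb => Germ.mul g ha hb)
    (fun x => Germ.one ρ x)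
    (fun _ _ _ ha => Germ.inv g ha)
    (fun y hy x => by
      rcases (hYm y).1 hy with h | ⟨p, hp, h⟩ | ⟨p, hp, h⟩
      · refine ⟨1, ?_, Or.inl rfl⟩
        rw [Set.mem_singleton_iff.1 h]
        exact germ_σ x
      · rw [← h]; exact hT _ p hp x
      · rw [← h]; exact hT _ p hp x)
    0
    (fun γ h a ha => by
      have : (Subgroup.closure (Y0 r S)).subtype (φ γ) 0 = 0 := hφ0 γ
      rw [this]; exact ha)
    (fun γ => by
      rcases germ_pc Set.univ (r γ) 0 b0 0 (germ_base g γ) with h | h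
      · have := h.2
        rwa [h00] at this
      · exact absurd (Set.mem_univ _) h.1)
    (fun γ x => hGp Set.univ γ x)
  exact ⟨_, inferInstance, Y, φ, hY, lo_H s, simple_H s, main.1, main.2⟩

end

end IFE

theorem isometric_frattini_embedding_into_fg_leftOrderable_simple
    (G : Type) [Group G] (hGfg : Group.FG G) (hG : IsLeftOrderable G) :
    ∃ (H : Type) (_ : Group H), Group.FG H ∧ IsLeftOrderable H ∧ IsSimpleGroup H ∧
      ∃ (X : Finset G) (Y : Finset H) (φ : G →* H),
        Generates X ∧ Generates Y ∧ IsFrattini φ ∧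
        ∀ g : G, wordLength Y (φ g) = wordLength X g := by
  obtain ⟨_, X, _, hX⟩ := Group.fg_iff'.1 hGfg
  obtain ⟨Γ, _, S, ψ, hS, hlo, hperf, hψ, hψl⟩ := IFE.stage1 hX hG
  obtain ⟨H, _, Y, φ, hY, hH, hsimp, hφ, hφl⟩ := IFE.stage2 S hS hlo hperf
  refine ⟨H, inferInstance, Group.fg_iff'.2 ⟨_, Y, rfl, hY⟩, hH, hsimp, X, Y, φ.comp ψ, hX, hY, ?_, ?_⟩
  · exact IFE.IsFrattini.comp' hψ hφ
  · intro g
    rw [MonoidHom.comp_apply, hφl, hψl]
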